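/- arXiv:math/0505428 — 2 statements merged into one kernel-verified Lean document; each statement's English description precedes it below -/
import Mathlib

section
/- Separation theorem: Suppose A generates an n-times integrated group bounded by M(1+|t|^m) (integers m ≥ n ≥ 0) and σ(A) = {iλ_k : k ∈ ℤ, k ≠ 0} as in the spectral assumption. Set σ⁻ := {iλ_k : k ≤ −1} and σ⁺ := {iλ_k : k ≥ 1}. Then there exist closed subspaces E₋ and E₊ of E such that: (i) E₋ ∩ E₊ = {0} and every x ∈ D(A^{m+1}) can be written x = x₋ + x₊ with x₋ ∈ E₋, x₊ ∈ E₊; (ii) S₊(t)E₋ ⊆ E₋, S₋(t)E₋ ⊆ E₋, S₊(t)E₊ ⊆ E₊ and S₋(t)E₊ ⊆ E₊ for all t ≥ 0; (iii) the part A₋ of A in E₋ (with domain {x ∈ D(A) ∩ E₋ : Ax ∈ E₋}) generates on E₋ an n-times integrated group bounded by M′(1+|t|^m) for some constant M′ (given by the restrictions of S₊, S₋ to E₋), and its spectrum satisfies σ(A₋) = σ⁻; similarly the part A₊ of A in E₊ generates an n-times integrated group bounded by M′(1+|t|^m) on E₊ and σ(A₊) = σ⁺. -/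
open MeasureTheory Complex Filter Topology Metric

namespace SpectralDecomp

variable {G : Type*} [NormedAddCommGroup G] [NormedSpace ℂ G]

/-- `R` is the bounded inverse of `z • I - A`. -/
structure ResolventAt (A : G →ₗ.[ℂ] G) (z : ℂ) (R : G →L[ℂ] G) : Prop where
  mem : ∀ y : G, R y ∈ A.domain
  solves : ∀ y : G, z • R y - A ⟨R y, mem y⟩ = y
  leftInv : ∀ x : A.domain, R (z • (x : G) - A x) = x

/-- The resolvent set of the (unbounded) operator `A`. -/
def resolventSet (A : G →ₗ.[ℂ] G) : Set ℂ :=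
  {z : ℂ | ∃ R : G →L[ℂ] G, ResolventAt A z R}

/-- The spectrum of the (unbounded) operator `A`. -/
def spectrumSet (A : G →ₗ.[ℂ] G) : Set ℂ := (resolventSet A)ᶜ

/-- Membership in the domain of `A ^ j`. -/
def InDomPow (A : G →ₗ.[ℂ] G) : ℕ → G → Prop
  | 0, _ => True
  | j + 1, x => ∃ h : x ∈ A.domain, InDomPow A j (A ⟨x, h⟩)

/-- The value `A ^ j x` for `x ∈ D(A ^ j)`. -/
noncomputable def powApply (A : G →ₗ.[ℂ] G) : (j : ℕ) → (x : G) → InDomPow A j x → G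
  | 0, x, _ => x
  | j + 1, x, h => powApply A j (A ⟨x, h.choose⟩) h.choose_spec

/-- `A` generates an `n`-times integrated group `(Sp, Sm)` bounded by `M * (1 + |t| ^ m)`. -/
def Generates (A : G →ₗ.[ℂ] G) (n m : ℕ) (M : ℝ) (Sp Sm : ℝ → G →L[ℂ] G) : Prop :=
  (∀ x : G, ContinuousOn (fun t : ℝ => Sp t x) (Set.Ici 0)) ∧
  (∀ x : G, ContinuousOn (fun t : ℝ => Sm t x) (Set.Ici 0)) ∧
  (∀ t : ℝ, 0 ≤ t → ‖Sp t‖ ≤ M * (1 + t ^ m)) ∧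
  (∀ t : ℝ, 0 ≤ t → ‖Sm t‖ ≤ M * (1 + t ^ m)) ∧
  (∀ z : ℂ, 0 < z.re →
    (∃ R : G →L[ℂ] G, ResolventAt A z R ∧
      ∀ x : G, R x = z ^ n • ∫ t in Set.Ioi (0 : ℝ), Complex.exp (-z * t) • Sp t x) ∧
    (∃ R : G →L[ℂ] G, ResolventAt A (-z) R ∧
      ∀ x : G, -(R x) = z ^ n • ∫ t in Set.Ioi (0 : ℝ), Complex.exp (-z * t) • Sm t x))

/-- The Riesz projection associated to the circle of centre `c` and radius `ρ`,
built from the resolvent function `Rres`. -/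
noncomputable def rieszProj (Rres : ℂ → G →L[ℂ] G) (c : ℂ) (ρ : ℝ) : G →L[ℂ] G :=
  (2 * Real.pi * Complex.I)⁻¹ • (∮ z in C(c, ρ), Rres z)

/-- `B` is the part of `A` in the subspace `F`: its domain is
`{x ∈ D(A) ∩ F : A x ∈ F}` and it acts as `A` there. -/
def IsPartOf (A : G →ₗ.[ℂ] G) (F : Submodule ℂ G) (B : ↥F →ₗ.[ℂ] ↥F) : Prop :=
  (∀ x : ↥F, x ∈ B.domain ↔ ∃ h : (x : G) ∈ A.domain, A ⟨(x : G), h⟩ ∈ F) ∧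
  (∀ (x : B.domain) (h : ((x : ↥F) : G) ∈ A.domain),
    ((B x : ↥F) : G) = A ⟨((x : ↥F) : G), h⟩)

section Resolvent

variable {A : G →ₗ.[ℂ] G} {z w a : ℂ} {R R' Ra T : G →L[ℂ] G} {F F₁ F₂ : Submodule ℂ G}

theorem ResolventAt.mem_graph (h : ResolventAt A z R) (y : G) :
    (R y, z • R y - y) ∈ A.graph := by
  refine A.mem_graph_iff.2 ⟨⟨R y, h.mem y⟩, rfl, ?_⟩
  have := h.solves y
  rw [sub_eq_iff_eq_add] at this
  simp only
  rw [this]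
  abel

theorem ResolventAt.apply_of_mem_graph (h : ResolventAt A z R) {x v : G}
    (hx : (x, v) ∈ A.graph) : R (z • x - v) = x := by
  obtain ⟨u, hu, huv⟩ := A.mem_graph_iff.1 hx
  simp only at hu huv
  rw [← hu, ← huv]
  exact h.leftInv u

theorem ResolventAt.of_graph (hg : ∀ y, (R y, z • R y - y) ∈ A.graph)
    (hl : ∀ x v, (x, v) ∈ A.graph → R (z • x - v) = x) : ResolventAt A z R := by
  refine ⟨fun y => A.mem_domain_of_mem_graph (hg y), fun y => ?_, fun x => hl _ _ (A.mem_graph x)⟩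
  have := (A.image_iff (A.mem_domain_of_mem_graph (hg y))).2 (hg y)
  rw [← this]
  abel

theorem ResolventAt.unique (h : ResolventAt A z R) (h' : ResolventAt A z R') : R = R' := by
  ext y
  have := h.apply_of_mem_graph (h'.mem_graph y)
  simpa using this

theorem ResolventAt.sub_eq (h : ResolventAt A z R) (h' : ResolventAt A w R') :
    R - R' = (w - z) • (R * R') := by
  ext y
  have := h.apply_of_mem_graph (h'.mem_graph y)
  simp only [map_sub, map_smul] at this
  simp only [sub_apply, smul_apply, mul_apply_eq_comp]
  linear_combination (norm := module) this

theorem ResolventAt.commute (h : ResolventAt A z R) (h' : ResolventAt A w R') :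
    Commute R R' := by
  by_cases hzw : w = z
  · subst hzw
    rw [h.unique h']
  · have h1 := h.sub_eq h'
    have h2 := h'.sub_eq h
    have h3 : (w - z) • (R * R') = (w - z) • (R' * R) := by
      rw [← h1, ← neg_sub R' R, h2]
      module
    exact smul_right_injective _ (sub_ne_zero.2 hzw) h3

/-- Finite Neumann expansion of the resolvent at `z` around the point `a`. -/
theorem ResolventAt.eq_sum_add (h : ResolventAt A z R) (ha : ResolventAt A a Ra) (k : ℕ) :
    R = ∑ j ∈ Finset.range k, (a - z) ^ j • Ra ^ (j + 1) + (a - z) ^ k • (R * Ra ^ k) := by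
  induction k with
  | zero => simp
  | succ k ih =>
    have h1 : R = Ra + (a - z) • (R * Ra) := by rw [← h.sub_eq ha]; abel
    have h2 : R * Ra ^ k = Ra ^ (k + 1) + (a - z) • (R * Ra ^ (k + 1)) := by
      conv_lhs => rw [h1]
      rw [add_mul, smul_mul_assoc, mul_assoc, ← pow_succ']
    rw [Finset.sum_range_succ]
    conv_lhs => rw [ih, h2]
    rw [pow_succ (a - z)]
    module

theorem ResolventAt.mem_graph_of_commute (ha : ResolventAt A a Ra) (hT : Commute Ra T) {x v : G}
    (hx : (x, v) ∈ A.graph) : (T x, T v) ∈ A.graph := by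
  have h1 := ha.apply_of_mem_graph hx
  have h2 : Ra (T (a • x - v)) = T x := by
    rw [← mul_apply_eq_comp, hT.eq, mul_apply_eq_comp, h1]
  have h3 := ha.mem_graph (T (a • x - v))
  rw [h2] at h3
  convert h3 using 2
  simp

theorem InDomPow.smul_add_smul : ∀ {k : ℕ} {x y : G} (_ : InDomPow A k x) (_ : InDomPow A k y)
    (c d : ℂ), InDomPow A k (c • x + d • y)
  | 0, _, _, _, _, _, _ => trivial
  | k + 1, x, y, ⟨hx, hx'⟩, ⟨hy, hy'⟩, c, d => by
    refine ⟨A.domain.add_mem (A.domain.smul_mem c hx) (A.domain.smul_mem d hy), ?_⟩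
    have h := hx'.smul_add_smul hy' c d
    rw [← A.map_smul, ← A.map_smul, ← A.map_add] at h
    exact h

theorem InDomPow.of_succ : ∀ {k : ℕ} {x : G} (_ : InDomPow A (k + 1) x), InDomPow A k x
  | 0, _, _ => trivial
  | _ + 1, _, ⟨hx, hx'⟩ => ⟨hx, hx'.of_succ⟩

theorem ResolventAt.exists_pow_apply_eq (ha : ResolventAt A a Ra) :
    ∀ {k : ℕ} {x : G} (_ : InDomPow A k x), ∃ y, (Ra ^ k) y = x
  | 0, x, _ => ⟨x, rfl⟩
  | k + 1, x, h => by
    obtain ⟨hx, hx'⟩ := id h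
    obtain ⟨y, hy⟩ := ha.exists_pow_apply_eq (h.of_succ.smul_add_smul hx' a (-1))
    refine ⟨y, ?_⟩
    rw [pow_succ', mul_apply_eq_comp, hy, neg_one_smul, ← sub_eq_add_neg]
    exact ha.leftInv ⟨x, hx⟩

theorem ResolventAt.pow_injective (ha : ResolventAt A a Ra) (k : ℕ) :
    Function.Injective (Ra ^ k : G →L[ℂ] G) := by
  rw [FunLike.coe_pow_eq_iterate]
  refine Function.Injective.iterate ?_ k
  refine (injective_iff_map_eq_zero Ra).2 fun y hy => ?_
  have := ha.mem_graph y
  rw [hy] at this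
  simpa using A.graph_fst_eq_zero_snd this rfl

variable (A F) in
/-- The part of `A` in the subspace `F`. -/
noncomputable def partOf : F →ₗ.[ℂ] F :=
  (A.graph.comap (F.subtype.prodMap F.subtype)).toLinearPMap

theorem mem_graph_partOf {x v : F} :
    (x, v) ∈ (partOf A F).graph ↔ ((x : G), (v : G)) ∈ A.graph := by
  rw [partOf, Submodule.toLinearPMap_graph_eq]
  · simp
  · rintro ⟨x, v⟩ hx h0
    simp only at h0
    subst h0
    have := A.graph_fst_eq_zero_snd hx (by simp)
    simpa using this

theorem isPartOf_partOf : IsPartOf A F (partOf A F) := by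
  constructor
  · intro x
    rw [LinearPMap.mem_domain_iff]
    constructor
    · rintro ⟨v, hv⟩
      rw [mem_graph_partOf] at hv
      have h := A.mem_domain_of_mem_graph hv
      refine ⟨h, ?_⟩
      rw [← (A.image_iff h).2 hv]
      exact v.2
    · rintro ⟨h, h'⟩
      exact ⟨⟨_, h'⟩, mem_graph_partOf.2 (A.mem_graph ⟨_, h⟩)⟩
  · intro x h
    exact (A.image_iff h).2 (mem_graph_partOf.1 ((partOf A F).mem_graph x))

variable (R) in
/-- The restriction of a bounded operator to an invariant subspace. -/
noncomputable def restrictTo (h : ∀ x ∈ F, R x ∈ F) : F →L[ℂ] F :=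
  (R.comp F.subtypeL).codRestrict F fun x => h x x.2

@[simp]
theorem coe_restrictTo_apply (h : ∀ x ∈ F, R x ∈ F) (x : F) :
    (restrictTo R h x : G) = R x := rfl

theorem resolventAt_partOf (hF : ∀ x ∈ F, R x ∈ F)
    (hg : ∀ y ∈ F, (R y, z • R y - y) ∈ A.graph)
    (hl : ∀ x ∈ F, ∀ v ∈ F, (x, v) ∈ A.graph → R (z • x - v) = x) :
    ResolventAt (partOf A F) z (restrictTo R hF) :=
  .of_graph (fun y => mem_graph_partOf.2 (hg y y.2)) fun x v h =>
    Subtype.ext (hl x x.2 v v.2 (mem_graph_partOf.1 h))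

theorem ResolventAt.part (h : ResolventAt A z R) (hF : ∀ x ∈ F, R x ∈ F) :
    ResolventAt (partOf A F) z (restrictTo R hF) :=
  resolventAt_partOf hF (fun y _ => h.mem_graph y) fun _ _ _ _ hx => h.apply_of_mem_graph hx

/-- If the resolvent of a closed operator converges strongly on an invariant closed subspace as the
parameter tends to `z`, then `z` lies in the resolvent set of the part in that subspace. -/
theorem mem_resolventSet_partOf_of_tendsto {ι : Type*} {l : Filter ι} [l.NeBot]
    (hA : IsClosed (A.graph : Set (G × G))) (hF : IsClosed (F : Set G))
    {μ : ι → ℂ} {S : ι → G →L[ℂ] G} (hS : ∀ᶠ i in l, ResolventAt A (μ i) (S i))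
    (hSF : ∀ᶠ i in l, ∀ x ∈ F, S i x ∈ F) (hμ : Tendsto μ l (𝓝 z))
    (hlim : ∀ x ∈ F, Tendsto (fun i => S i x) l (𝓝 (R x))) :
    z ∈ resolventSet (partOf A F) := by
  have hmem : ∀ x ∈ F, R x ∈ F := fun x hx =>
    hF.mem_of_tendsto (hlim x hx) (hSF.mono fun i hi => hi x hx)
  refine ⟨_, resolventAt_partOf (R := R) hmem (fun y hy => ?_) fun x hx v hv hxv => ?_⟩
  · refine hA.mem_of_tendsto (b := l) (f := fun i => (S i y, μ i • S i y - y)) ?_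
      (hS.mono fun i hi => hi.mem_graph y)
    exact (hlim y hy).prodMk_nhds ((hμ.smul (hlim y hy)).sub_const y)
  · have h1 : Tendsto (fun i => μ i • S i x - S i v) l (𝓝 (z • R x - R v)) :=
      (hμ.smul (hlim x hx)).sub (hlim v hv)
    have h2 : Tendsto (fun i => μ i • S i x - S i v) l (𝓝 x) := by
      refine tendsto_const_nhds.congr' (hS.mono fun i hi => ?_)
      have := hi.apply_of_mem_graph hxv
      rw [map_sub, map_smul] at this
      exact this.symm
    rw [map_sub, map_smul]
    exact tendsto_nhds_unique h1 h2

/-- If a power of the resolvent of `A` splits as `T₁ + T₂` with `Tᵢ` mapping into `Fᵢ`, then a common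
point of the resolvent sets of the parts of `A` in `F₁` and `F₂` is in the resolvent set of `A`. -/
theorem mem_resolventSet_of_partOf (ha : ResolventAt A a Ra) {T₁ T₂ : G →L[ℂ] G} {k : ℕ}
    (hsum : T₁ + T₂ = Ra ^ k) (hT₁ : ∀ x, T₁ x ∈ F₁) (hT₂ : ∀ x, T₂ x ∈ F₂)
    (hc₁ : Commute Ra T₁) (hc₂ : Commute Ra T₂)
    (h₁ : z ∈ resolventSet (partOf A F₁)) (h₂ : z ∈ resolventSet (partOf A F₂)) :
    z ∈ resolventSet A := by
  obtain ⟨R₁, h₁⟩ := h₁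
  obtain ⟨R₂, h₂⟩ := h₂
  have hsum' : ∀ x, T₁ x + T₂ x = (Ra ^ k) x := fun x => by rw [← hsum]; rfl
  set Q : G →L[ℂ] G := F₁.subtypeL ∘L R₁ ∘L T₁.codRestrict F₁ hT₁ +
    F₂.subtypeL ∘L R₂ ∘L T₂.codRestrict F₂ hT₂ with hQ
  have hQg : ∀ y, (Q y, z • Q y - (Ra ^ k) y) ∈ A.graph := by
    intro y
    have e₁ := mem_graph_partOf.1 (h₁.mem_graph (T₁.codRestrict F₁ hT₁ y))
    have e₂ := mem_graph_partOf.1 (h₂.mem_graph (T₂.codRestrict F₂ hT₂ y))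
    convert A.graph.add_mem e₁ e₂ using 1
    ext
    · simp [hQ]
    · simp only [hQ, ← hsum']
      simp
      abel
  have hNg : ∀ i : ℕ, ∀ y, ((∑ j ∈ Finset.range i, (a - z) ^ j • Ra ^ (j + 1) : G →L[ℂ] G) y,
      z • (∑ j ∈ Finset.range i, (a - z) ^ j • Ra ^ (j + 1) : G →L[ℂ] G) y - y
        + (a - z) ^ i • (Ra ^ i) y) ∈ A.graph := by
    intro i y
    induction i with
    | zero => simp
    | succ i ih =>
      have e := A.graph.smul_mem ((a - z) ^ i) (ha.mem_graph ((Ra ^ i) y))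
      convert A.graph.add_mem ih e using 1
      rw [← mul_apply_eq_comp, ← pow_succ']
      simp only [Finset.sum_range_succ, Prod.smul_mk, Prod.mk_add_mk, add_apply, smul_apply,
        pow_succ (a - z)]
      congr 1
      module
  have hinj : ∀ u, (u, z • u) ∈ A.graph → u = 0 := by
    intro u hu
    have e₁ : T₁ u = 0 := by
      have hg := ha.mem_graph_of_commute hc₁ hu
      rw [map_smul] at hg
      have := h₁.apply_of_mem_graph (x := ⟨T₁ u, hT₁ u⟩) (v := z • ⟨T₁ u, hT₁ u⟩)
        (mem_graph_partOf.2 hg)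
      rw [sub_self, map_zero] at this
      exact (congrArg Subtype.val this).symm
    have e₂ : T₂ u = 0 := by
      have hg := ha.mem_graph_of_commute hc₂ hu
      rw [map_smul] at hg
      have := h₂.apply_of_mem_graph (x := ⟨T₂ u, hT₂ u⟩) (v := z • ⟨T₂ u, hT₂ u⟩)
        (mem_graph_partOf.2 hg)
      rw [sub_self, map_zero] at this
      exact (congrArg Subtype.val this).symm
    apply ha.pow_injective k
    rw [← hsum', e₁, e₂, map_zero, add_zero]
  set P : G →L[ℂ] G := ∑ j ∈ Finset.range k, (a - z) ^ j • Ra ^ (j + 1) + (a - z) ^ k • Q with hP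
  have hPg : ∀ y, (P y, z • P y - y) ∈ A.graph := by
    intro y
    convert A.graph.add_mem (hNg k y) (A.graph.smul_mem ((a - z) ^ k) (hQg y)) using 1
    simp only [hP, add_apply, smul_apply, Prod.smul_mk, Prod.mk_add_mk]
    congr 1
    module
  refine ⟨P, .of_graph hPg fun x v hxv => ?_⟩
  rw [← sub_eq_zero]
  apply hinj
  convert A.graph.sub_mem (hPg (z • x - v)) hxv using 1
  simp only [Prod.mk_sub_mk]
  congr 1
  module

end Resolvent

section LineIntegrals

theorem sub_ofReal_ne_zero {b : ℂ} (hb : b.im ≠ 0) (s : ℝ) : b - s ≠ 0 := fun h =>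
  hb (by simpa using congrArg Complex.im h)

theorem norm_inv_sub_ofReal_le {b : ℂ} (hb : b.im ≠ 0) (s : ℝ) : ‖(b - s)⁻¹‖ ≤ |b.im|⁻¹ := by
  rw [norm_inv]
  refine inv_anti₀ (abs_pos.2 hb) ?_
  simpa using Complex.abs_im_le_norm (b - s)

theorem continuous_inv_sub_ofReal {b : ℂ} (hb : b.im ≠ 0) : Continuous fun s : ℝ => (b - s)⁻¹ :=
  (by fun_prop : Continuous fun s : ℝ => b - s).inv₀ (sub_ofReal_ne_zero hb)

theorem norm_inv_sub_ofReal_sq (b : ℂ) (s : ℝ) :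
    ‖(b - s)⁻¹‖ ^ 2 = ((s - b.re) ^ 2 + b.im ^ 2)⁻¹ := by
  rw [norm_inv, inv_pow, ← Complex.normSq_eq_norm_sq, Complex.normSq_apply]
  simp
  ring

theorem integrable_inv_sq_add_sq {y : ℝ} (hy : y ≠ 0) (x : ℝ) :
    Integrable fun s : ℝ => ((s - x) ^ 2 + y ^ 2)⁻¹ := by
  have h := ((integrable_inv_one_add_sq.comp_div hy).comp_sub_right x).const_mul (y ^ 2)⁻¹
  refine h.congr (.of_forall fun s => ?_)
  field_simp
  ring

theorem memLp_inv_sub_ofReal {b : ℂ} (hb : b.im ≠ 0) :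
    MemLp (fun s : ℝ => (b - s)⁻¹) 2 := by
  rw [memLp_two_iff_integrable_sq_norm (continuous_inv_sub_ofReal hb).aestronglyMeasurable]
  simp_rw [norm_inv_sub_ofReal_sq]
  exact integrable_inv_sq_add_sq hb _

theorem memLp_inv_sub_ofReal_pow {b : ℂ} (hb : b.im ≠ 0) (k : ℕ) :
    MemLp (fun s : ℝ => (b - s)⁻¹ ^ (k + 1)) 2 := by
  have h := (memLp_inv_sub_ofReal hb).const_mul ((|b.im|⁻¹ ^ k : ℝ) : ℂ)
  refine h.mono ((continuous_inv_sub_ofReal hb).pow _).aestronglyMeasurable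
    (.of_forall fun s => ?_)
  rw [pow_succ, norm_mul, norm_mul, norm_pow, Complex.norm_real, norm_pow, norm_inv |b.im|,
    norm_abs_eq_norm, Real.norm_eq_abs]
  gcongr
  exact norm_inv_sub_ofReal_le hb s

theorem integrable_inv_sub_pow_mul {b c : ℂ} (hb : b.im ≠ 0) (hc : c.im ≠ 0) (k : ℕ) :
    Integrable fun s : ℝ => (b - s)⁻¹ ^ (k + 1) * (c - s)⁻¹ :=
  (memLp_inv_sub_ofReal_pow hb k).integrable_mul (memLp_inv_sub_ofReal hc)

theorem tendsto_inv_sub_ofReal_atTop (b : ℂ) :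
    Tendsto (fun s : ℝ => (b - s)⁻¹) atTop (𝓝 0) := by
  refine tendsto_inv₀_cobounded.comp ?_
  have h : Tendsto (fun s : ℝ => (s : ℂ)) atTop (Bornology.cobounded ℂ) := by
    rw [← tendsto_norm_atTop_iff_cobounded]
    simpa using tendsto_abs_atTop_atTop
  exact (tendsto_const_sub_cobounded b).comp h

theorem tendsto_inv_sub_ofReal_atBot (b : ℂ) :
    Tendsto (fun s : ℝ => (b - s)⁻¹) atBot (𝓝 0) := by
  have h := ((tendsto_inv_sub_ofReal_atTop (-b)).comp tendsto_neg_atBot_atTop).neg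
  rw [neg_zero] at h
  refine h.congr fun s => ?_
  simp only [Function.comp_apply, ofReal_neg, ← inv_neg]
  ring_nf

theorem integral_inv_sub_pow_eq_zero {b : ℂ} (hb : b.im ≠ 0) (k : ℕ) :
    ∫ s : ℝ, (b - s)⁻¹ ^ (k + 2) = 0 := by
  have hd : ∀ s : ℝ, HasDerivAt (fun s : ℝ => ((k : ℂ) + 1)⁻¹ * (b - s)⁻¹ ^ (k + 1))
      ((b - s)⁻¹ ^ (k + 2)) s := by
    intro s
    have h1 : HasDerivAt (fun s : ℝ => b - s) (-1) s := by
      simpa using (Complex.ofRealCLM.hasDerivAt (x := s)).const_sub b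
    have h2 := ((h1.fun_inv (sub_ofReal_ne_zero hb s)).fun_pow (k + 1)).const_mul ((k : ℂ) + 1)⁻¹
    refine h2.congr_deriv ?_
    have h3 : (k : ℂ) + 1 ≠ 0 := by exact_mod_cast k.succ_ne_zero
    rw [Nat.add_sub_cancel, neg_neg, one_div, ← inv_pow]
    push_cast
    rw [← mul_assoc, ← mul_assoc, inv_mul_cancel₀ h3]
    ring
  have hi : Integrable fun s : ℝ => (b - s)⁻¹ ^ (k + 2) := by
    simpa only [← pow_succ] using integrable_inv_sub_pow_mul hb hb k
  have h := integral_of_hasDerivAt_of_tendsto hd hi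
    (((tendsto_inv_sub_ofReal_atBot b).pow (k + 1)).const_mul _)
    (((tendsto_inv_sub_ofReal_atTop b).pow (k + 1)).const_mul _)
  simpa using h

theorem tendsto_log_sub_log_atTop (b : ℂ) :
    Tendsto (fun s : ℝ => Complex.log (s - b) - Real.log s) atTop (𝓝 0) := by
  have h : Tendsto (fun s : ℝ => 1 + b * ((0 : ℂ) - s)⁻¹) atTop (𝓝 1) := by
    simpa using ((tendsto_inv_sub_ofReal_atTop 0).const_mul b).const_add 1
  have h' := h.clog (by simp [Complex.slitPlane])
  rw [Complex.log_one] at h'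
  refine h'.congr' ?_
  filter_upwards [eventually_gt_atTop 0, eventually_gt_atTop b.re] with s hs hsb
  have hne : (s : ℂ) ≠ 0 := by exact_mod_cast hs.ne'
  have e : (s : ℂ) - b = s * (1 + b * ((0 : ℂ) - s)⁻¹) := by
    rw [zero_sub, inv_neg]
    field_simp
    ring
  have hne' : 1 + b * ((0 : ℂ) - s)⁻¹ ≠ 0 := by
    intro h0
    rw [h0, mul_zero] at e
    have := congrArg Complex.re e
    simp at this
    linarith
  rw [e, Complex.log_ofReal_mul hs hne']
  ring

theorem tendsto_log_sub_log_atBot {b : ℂ} {σ : ℝ} (hσ : σ = 1 ∧ b.im < 0 ∨ σ = -1 ∧ 0 < b.im) :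
    Tendsto (fun s : ℝ => Complex.log (s - b) - Real.log (-s)) atBot (𝓝 (σ * (Real.pi * I))) := by
  have hb : b.im ≠ 0 := by rcases hσ with h | h <;> simp [h.2.ne, h.2.ne']
  have h : Tendsto (fun s : ℝ => -1 - b * ((0 : ℂ) - s)⁻¹) atBot (𝓝 (-1)) := by
    simpa using ((tendsto_inv_sub_ofReal_atBot 0).const_mul b).const_sub (-1)
  have him : ∀ s : ℝ, (-1 - b * ((0 : ℂ) - s)⁻¹).im = b.im / s := by
    intro s
    have : -1 - b * ((0 : ℂ) - s)⁻¹ = -1 + b / s := by rw [zero_sub, inv_neg]; ring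
    rw [this, add_im, Complex.div_ofReal_im]
    simp
  have h' : Tendsto (fun s : ℝ => Complex.log (-1 - b * ((0 : ℂ) - s)⁻¹)) atBot
      (𝓝 (σ * (Real.pi * I))) := by
    rcases hσ with ⟨rfl, hb⟩ | ⟨rfl, hb⟩
    · have hl := tendsto_log_nhdsWithin_im_nonneg_of_re_neg_of_im_zero
        (z := -1) (by simp) (by simp)
      have hl' := hl.comp (tendsto_nhdsWithin_iff.2 ⟨h, ?_⟩)
      · simpa [Function.comp_def] using hl'
      · filter_upwards [eventually_lt_atBot 0] with s hs
        simp only [him]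
        exact (div_pos_of_neg_of_neg hb hs).le
    · have hl := tendsto_log_nhdsWithin_im_neg_of_re_neg_of_im_zero
        (z := -1) (by simp) (by simp)
      have hl' := hl.comp (tendsto_nhdsWithin_iff.2 ⟨h, ?_⟩)
      · simpa [Function.comp_def] using hl'
      · filter_upwards [eventually_lt_atBot 0] with s hs
        simp only [him]
        exact div_neg_of_pos_of_neg hb hs
  refine h'.congr' ?_
  filter_upwards [eventually_lt_atBot 0] with s hs
  have hne : (s : ℂ) ≠ 0 := by exact_mod_cast hs.ne
  have e : (s : ℂ) - b = (-s : ℝ) * (-1 - b * ((0 : ℂ) - s)⁻¹) := by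
    rw [zero_sub, inv_neg]
    push_cast
    field_simp
    ring
  have hne' : -1 - b * ((0 : ℂ) - s)⁻¹ ≠ 0 := by
    intro h0
    have := him s
    rw [h0] at this
    exact div_ne_zero hb hs.ne this.symm
  rw [e, Complex.log_ofReal_mul (neg_pos.2 hs) hne']
  ring

theorem integral_inv_sub_mul_inv_sub {b c : ℂ} {σ τ : ℝ} (hbc : b ≠ c)
    (hσ : σ = 1 ∧ b.im < 0 ∨ σ = -1 ∧ 0 < b.im) (hτ : τ = 1 ∧ c.im < 0 ∨ τ = -1 ∧ 0 < c.im) :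
    ∫ s : ℝ, (b - s)⁻¹ * (c - s)⁻¹ = (c - b)⁻¹ * ((σ - τ) * (Real.pi * I)) := by
  have hb : b.im ≠ 0 := by rcases hσ with h | h <;> simp [h.2.ne, h.2.ne']
  have hc : c.im ≠ 0 := by rcases hτ with h | h <;> simp [h.2.ne, h.2.ne']
  have hcb : c - b ≠ 0 := sub_ne_zero.2 hbc.symm
  have hlog : ∀ d : ℂ, d.im ≠ 0 → ∀ s : ℝ,
      HasDerivAt (fun s : ℝ => Complex.log (s - d)) (s - d : ℂ)⁻¹ s := by
    intro d hd s
    have h1 : HasDerivAt (fun s : ℝ => (s : ℂ) - d) 1 s := by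
      simpa using (Complex.ofRealCLM.hasDerivAt (x := s)).sub_const d
    simpa using h1.clog_real (Or.inr (by simpa using hd))
  have hd : ∀ s : ℝ, HasDerivAt
      (fun s : ℝ => (c - b)⁻¹ * (Complex.log (s - c) - Complex.log (s - b)))
      ((b - s)⁻¹ * (c - s)⁻¹) s := by
    intro s
    refine (((hlog c hc s).fun_sub (hlog b hb s)).const_mul (c - b)⁻¹).congr_deriv ?_
    have h1 := sub_ofReal_ne_zero hb s
    have h2 := sub_ofReal_ne_zero hc s
    rw [← neg_sub c (s : ℂ), ← neg_sub b (s : ℂ), inv_neg, inv_neg]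
    field_simp
    ring
  have hi : Integrable fun s : ℝ => (b - s)⁻¹ * (c - s)⁻¹ := by
    simpa using integrable_inv_sub_pow_mul hb hc 0
  have htop : Tendsto (fun s : ℝ => (c - b)⁻¹ * (Complex.log (s - c) - Complex.log (s - b)))
      atTop (𝓝 0) := by
    simpa using ((tendsto_log_sub_log_atTop c).sub (tendsto_log_sub_log_atTop b)).const_mul
      (c - b)⁻¹
  have hbot : Tendsto (fun s : ℝ => (c - b)⁻¹ * (Complex.log (s - c) - Complex.log (s - b)))
      atBot (𝓝 ((c - b)⁻¹ * (τ * (Real.pi * I) - σ * (Real.pi * I)))) := by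
    simpa using ((tendsto_log_sub_log_atBot hτ).sub (tendsto_log_sub_log_atBot hσ)).const_mul
      (c - b)⁻¹
  rw [integral_of_hasDerivAt_of_tendsto hd hi hbot htop]
  ring

theorem integral_inv_sub_pow_mul_succ {b c : ℂ} (hbc : b ≠ c) (hb : b.im ≠ 0) (hc : c.im ≠ 0)
    (k : ℕ) : ∫ s : ℝ, (b - s)⁻¹ ^ (k + 2) * (c - s)⁻¹ =
      (b - c)⁻¹ * ∫ s : ℝ, (b - s)⁻¹ ^ (k + 1) * (c - s)⁻¹ := by
  have hbc' : b - c ≠ 0 := sub_ne_zero.2 hbc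
  have e : ∀ s : ℝ, (b - s)⁻¹ ^ (k + 2) * (c - s)⁻¹ =
      (b - c)⁻¹ * ((b - s)⁻¹ ^ (k + 1) * (c - s)⁻¹ - (b - s)⁻¹ ^ (k + 2)) := by
    intro s
    have h1 := sub_ofReal_ne_zero hb s
    have h2 := sub_ofReal_ne_zero hc s
    have h3 : (b - s)⁻¹ * (c - s)⁻¹ = (b - c)⁻¹ * ((c - s)⁻¹ - (b - s)⁻¹) := by
      field_simp
      ring
    linear_combination (b - s)⁻¹ ^ (k + 1) * h3
  have hi : Integrable fun s : ℝ => (b - s)⁻¹ ^ (k + 2) := by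
    simpa only [← pow_succ] using integrable_inv_sub_pow_mul hb hb k
  simp_rw [e]
  rw [integral_const_mul, integral_sub (integrable_inv_sub_pow_mul hb hc k) hi,
    integral_inv_sub_pow_eq_zero hb, sub_zero]

theorem integral_inv_sub_pow_mul_of_im_neg {b c : ℂ} (hb : b.im < 0) (hc : c.im < 0) (k : ℕ) :
    ∫ s : ℝ, (b - s)⁻¹ ^ (k + 1) * (c - s)⁻¹ = 0 := by
  rcases eq_or_ne b c with rfl | hbc
  · simpa only [← pow_succ] using integral_inv_sub_pow_eq_zero hb.ne k
  induction k with
  | zero =>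
    simpa using integral_inv_sub_mul_inv_sub hbc (Or.inl ⟨rfl, hb⟩) (Or.inl ⟨rfl, hc⟩)
  | succ k ih => rw [integral_inv_sub_pow_mul_succ hbc hb.ne hc.ne, ih, mul_zero]

theorem integral_inv_sub_pow_mul_of_im_pos {b c : ℂ} (hb : b.im < 0) (hc : 0 < c.im) (k : ℕ) :
    ∫ s : ℝ, (b - s)⁻¹ ^ (k + 1) * (c - s)⁻¹ = -(2 * Real.pi * I) * (b - c)⁻¹ ^ (k + 1) := by
  have hbc : b ≠ c := by
    rintro rfl
    exact hb.not_gt hc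
  induction k with
  | zero =>
    have h := integral_inv_sub_mul_inv_sub hbc (Or.inl ⟨rfl, hb⟩) (Or.inr ⟨rfl, hc⟩)
    simp only [zero_add, pow_one, h]
    rw [← neg_sub b c, inv_neg]
    push_cast
    ring
  | succ k ih =>
    rw [integral_inv_sub_pow_mul_succ hbc hb.ne hc.ne', ih]
    ring

end LineIntegrals

section ContourIntegrals

variable {A : G →ₗ.[ℂ] G} {R : ℂ → G →L[ℂ] G} {a μ : ℂ} {S : G →L[ℂ] G}

theorem ResolventAt.tendsto_of_tendsto {ι : Type*} {l : Filter ι} {ν : ι → ℂ}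
    {Q : ι → G →L[ℂ] G} (h : ResolventAt A μ S) (hν : Tendsto ν l (𝓝 μ))
    (hQ : ∀ᶠ i in l, ResolventAt A (ν i) (Q i)) : Tendsto Q l (𝓝 S) := by
  have h0 : Tendsto (fun i => ‖ν i - μ‖ * (2 * ‖S‖ * ‖S‖)) l (𝓝 0) := by
    have := (tendsto_iff_norm_sub_tendsto_zero.1 hν).mul_const (2 * ‖S‖ * ‖S‖)
    rwa [zero_mul] at this
  have hsmall : ∀ᶠ i in l, ‖ν i - μ‖ * ‖S‖ < 1 / 2 := by
    have := (tendsto_iff_norm_sub_tendsto_zero.1 hν).mul_const ‖S‖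
    rw [zero_mul] at this
    exact this.eventually_lt_const (by norm_num)
  rw [tendsto_iff_norm_sub_tendsto_zero]
  refine squeeze_zero' (.of_forall fun i => norm_nonneg _) ?_ h0
  filter_upwards [hQ, hsmall] with i hi his
  have h1 : ‖Q i - S‖ ≤ ‖ν i - μ‖ * (‖Q i‖ * ‖S‖) := by
    rw [hi.sub_eq h, norm_smul, norm_sub_rev μ]
    gcongr
    exact norm_mul_le _ _
  have h2 : ‖Q i‖ ≤ ‖S‖ + ‖Q i - S‖ := by
    simpa [add_comm] using norm_add_le S (Q i - S)
  have h3 : ‖Q i‖ ≤ 2 * ‖S‖ := by nlinarith [norm_nonneg (Q i), norm_nonneg S]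
  calc ‖Q i - S‖ ≤ ‖ν i - μ‖ * (‖Q i‖ * ‖S‖) := h1
    _ ≤ ‖ν i - μ‖ * (2 * ‖S‖ * ‖S‖) := by gcongr

theorem continuous_resolvent_comp {X : Type*} [TopologicalSpace X] {f : X → ℂ}
    (hf : Continuous f) (hR : ∀ x, ResolventAt A (f x) (R (f x))) :
    Continuous fun x => R (f x) :=
  continuous_iff_continuousAt.2 fun x =>
    (hR x).tendsto_of_tendsto hf.continuousAt (.of_forall hR)

theorem integrable_inv_sub_mul_smul {f : ℝ → ℂ} (hμ : μ.im ≠ 0)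
    (hi : Integrable fun s : ℝ => f s • R s) :
    Integrable fun s : ℝ => (f s * (μ - s)⁻¹) • R s := by
  simp_rw [mul_comm (f _), mul_smul]
  exact hi.bdd_smul _ (continuous_inv_sub_ofReal hμ).aestronglyMeasurable
    (.of_forall (norm_inv_sub_ofReal_le hμ))

theorem commute_integral {X : Type*} [MeasurableSpace X] {ν : Measure X}
    {f : X → G →L[ℂ] G} (h : ∀ x, Commute S (f x)) :
    Commute S (∫ x, f x ∂ν) := by
  by_cases hf : Integrable f ν
  · rw [Commute, SemiconjBy, ← integral_const_mul_of_integrable hf,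
      ← integral_mul_const_of_integrable hf]
    exact integral_congr_ae (.of_forall h)
  · rw [integral_undef hf]
    exact Commute.zero_right S

variable [CompleteSpace G]

theorem ResolventAt.mul_integral (hS : ResolventAt A μ S) (hR : ∀ s : ℝ, ResolventAt A s (R s))
    {f : ℝ → ℂ} (hμ : μ.im ≠ 0) (hi : Integrable fun s : ℝ => f s • R s)
    (hfi : Integrable fun s : ℝ => f s * (μ - s)⁻¹) :
    S * (∫ s : ℝ, f s • R s) =
      (∫ s : ℝ, (f s * (μ - s)⁻¹) • R s) - (∫ s : ℝ, f s * (μ - s)⁻¹) • S := by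
  rw [← integral_const_mul_of_integrable hi, ← integral_smul_const (fun s : ℝ => f s * (μ - s)⁻¹) S,
    ← integral_sub (integrable_inv_sub_mul_smul hμ hi) (hfi.smul_const S)]
  congr 1
  ext1 s
  have h := (hR s).sub_eq hS
  rw [← smul_sub, h, smul_smul, mul_assoc, inv_mul_cancel₀ (sub_ofReal_ne_zero hμ s), mul_one,
    mul_smul_comm, (hS.commute (hR s)).eq]

theorem ResolventAt.mul_integral_of_im_neg (hS : ResolventAt A μ S)
    (hR : ∀ s : ℝ, ResolventAt A s (R s)) (ha : a.im < 0) (hμ : μ.im < 0) {k : ℕ}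
    (hi : Integrable fun s : ℝ => (a - s)⁻¹ ^ (k + 1) • R s) :
    S * (∫ s : ℝ, (a - s)⁻¹ ^ (k + 1) • R s) =
      ∫ s : ℝ, ((a - s)⁻¹ ^ (k + 1) * (μ - s)⁻¹) • R s := by
  rw [hS.mul_integral hR hμ.ne hi (integrable_inv_sub_pow_mul ha.ne hμ.ne k),
    integral_inv_sub_pow_mul_of_im_neg ha hμ, zero_smul, sub_zero]

theorem ResolventAt.mul_integral_of_im_pos (hS : ResolventAt A μ S)
    (hR : ∀ s : ℝ, ResolventAt A s (R s)) (ha : a.im < 0) (hμ : 0 < μ.im) {k : ℕ}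
    (hi : Integrable fun s : ℝ => (a - s)⁻¹ ^ (k + 1) • R s) :
    S * (∫ s : ℝ, (a - s)⁻¹ ^ (k + 1) • R s) =
      (∫ s : ℝ, ((a - s)⁻¹ ^ (k + 1) * (μ - s)⁻¹) • R s) +
        (2 * Real.pi * I * (a - μ)⁻¹ ^ (k + 1)) • S := by
  rw [hS.mul_integral hR hμ.ne' hi (integrable_inv_sub_pow_mul ha.ne hμ.ne' k),
    integral_inv_sub_pow_mul_of_im_pos ha hμ, neg_mul, neg_smul, sub_neg_eq_add]

theorem ResolventAt.pow_mul_integral (hS : ResolventAt A a S)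
    (hR : ∀ s : ℝ, ResolventAt A s (R s)) (ha : a.im < 0) {k : ℕ}
    (hi : Integrable fun s : ℝ => (a - s)⁻¹ ^ (k + 1) • R s) (j : ℕ) :
    Integrable (fun s : ℝ => (a - s)⁻¹ ^ (k + j + 1) • R s) ∧
    S ^ j * (∫ s : ℝ, (a - s)⁻¹ ^ (k + 1) • R s) = ∫ s : ℝ, (a - s)⁻¹ ^ (k + j + 1) • R s := by
  induction j with
  | zero => simpa using hi
  | succ j ih =>
    constructor
    · exact integrable_inv_sub_mul_smul ha.ne ih.1
    · rw [pow_succ', mul_assoc, ih.2, hS.mul_integral_of_im_neg hR ha ha ih.1]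
      simp_rw [← pow_succ]
      rfl

theorem integrable_prod_inv_sub_smul {V : Type*} [NormedAddCommGroup V] [NormedSpace ℂ V]
    {f : ℝ → ℂ} {g : ℝ → V} {ε : ℝ} (hε : ε ≠ 0) (hf : MemLp f 2) (hfc : Continuous f)
    (hg : Integrable g) (hgc : Continuous g) :
    Integrable (fun p : ℝ × ℝ => (f p.1 * ((p.1 - ε * I : ℂ) - p.2)⁻¹) • g p.2)
      (volume.prod volume) := by
  have h1 : Integrable (fun p : ℝ × ℝ => ‖f p.1‖ ^ 2 * ‖g p.2‖) (volume.prod volume) :=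
    ((memLp_two_iff_integrable_sq_norm hf.1).1 hf).mul_prod hg.norm
  have h2 : Integrable (fun p : ℝ × ℝ => ‖g p.2‖ * ((p.1 - p.2 - 0) ^ 2 + ε ^ 2)⁻¹)
      (volume.prod volume) :=
    hg.norm.convolution_integrand (ContinuousLinearMap.mul ℝ ℝ) (integrable_inv_sq_add_sq hε 0)
  have him : ∀ s : ℝ, (s - ε * I : ℂ).im = -ε := fun s => by simp
  have hne : ∀ p : ℝ × ℝ, (p.1 - ε * I : ℂ) - p.2 ≠ 0 := fun p =>
    sub_ofReal_ne_zero (by rw [him]; exact neg_ne_zero.2 hε) _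
  refine (h1.add h2).mono ?_ (.of_forall fun p => ?_)
  · refine Continuous.aestronglyMeasurable ?_
    refine Continuous.smul (.mul (hfc.comp continuous_fst) (.inv₀ ?_ hne)) (hgc.comp continuous_snd)
    fun_prop
  · have h3 := norm_inv_sub_ofReal_sq (p.1 - ε * I) p.2
    have h4 : (p.2 - (p.1 - ε * I : ℂ).re) ^ 2 + (p.1 - ε * I : ℂ).im ^ 2
        = (p.1 - p.2 - 0) ^ 2 + ε ^ 2 := by
      rw [him]
      simp
      ring
    rw [h4] at h3
    rw [norm_smul, norm_mul, Pi.add_apply, ← h3]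
    refine le_trans ?_ (le_abs_self _)
    have := norm_nonneg (g p.2)
    nlinarith [sq_nonneg (‖f p.1‖ - ‖((p.1 - ε * I : ℂ) - p.2)⁻¹‖),
      mul_nonneg (norm_nonneg (g p.2)) (sq_nonneg (‖f p.1‖ - ‖((p.1 - ε * I : ℂ) - p.2)⁻¹‖)),
      mul_nonneg (norm_nonneg (g p.2)) (mul_nonneg (norm_nonneg (f p.1))
        (norm_nonneg ((p.1 - ε * I : ℂ) - p.2)⁻¹))]

theorem integral_shift_mul_integral (hR : ∀ s : ℝ, ResolventAt A s (R s)) (ha : a.im < 0)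
    {k : ℕ} (hi : Integrable fun s : ℝ => (a - s)⁻¹ ^ (k + 1) • R s) {ε : ℝ} (hε : 0 < ε)
    (hRε : ∀ s : ℝ, ResolventAt A (s - ε * I) (R (s - ε * I)))
    (hiε : Integrable fun s : ℝ => (a - s)⁻¹ ^ (k + 1) • R (s - ε * I)) :
    (∫ s : ℝ, (a - s)⁻¹ ^ (k + 1) • R (s - ε * I)) * (∫ s : ℝ, (a - s)⁻¹ ^ (k + 1) • R s) =
      (2 * Real.pi * I) • ∫ t : ℝ, (a - ε * I - t)⁻¹ ^ (k + 1) • (a - t)⁻¹ ^ (k + 1) • R t := by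
  have hw : Continuous fun s : ℝ => (a - s)⁻¹ ^ (k + 1) := (continuous_inv_sub_ofReal ha.ne).pow _
  have hRc : Continuous fun s : ℝ => R s := continuous_resolvent_comp continuous_ofReal hR
  have him : ∀ s : ℝ, (s - ε * I : ℂ).im = -ε := fun s => by simp
  have him' : ∀ s : ℝ, (s + ε * I : ℂ).im = ε := fun s => by simp
  have hF : Integrable (Function.uncurry fun s t : ℝ =>
      ((a - s)⁻¹ ^ (k + 1) * ((s - ε * I : ℂ) - t)⁻¹) • (a - t)⁻¹ ^ (k + 1) • R t)
      (volume.prod volume) :=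
    integrable_prod_inv_sub_smul (f := fun s : ℝ => (a - s)⁻¹ ^ (k + 1))
      (g := fun t : ℝ => (a - t)⁻¹ ^ (k + 1) • R t) hε.ne'
      (memLp_inv_sub_ofReal_pow ha.ne k) hw hi (hw.smul hRc)
  calc _ = ∫ s : ℝ, (a - s)⁻¹ ^ (k + 1) •
        ∫ t : ℝ, ((a - t)⁻¹ ^ (k + 1) * ((s - ε * I : ℂ) - t)⁻¹) • R t := by
        rw [← integral_mul_const_of_integrable hiε]
        congr 1
        ext1 s
        rw [smul_mul_assoc, (hRε s).mul_integral_of_im_neg hR ha (by rw [him]; linarith) hi]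
    _ = ∫ s : ℝ, ∫ t : ℝ, ((a - s)⁻¹ ^ (k + 1) * ((s - ε * I : ℂ) - t)⁻¹) •
          (a - t)⁻¹ ^ (k + 1) • R t := by
        congr 1
        ext1 s
        rw [← integral_smul]
        congr 1
        ext1 t
        simp only [smul_smul]
        congr 1
        ring
    _ = ∫ t : ℝ, ∫ s : ℝ, ((a - s)⁻¹ ^ (k + 1) * ((s - ε * I : ℂ) - t)⁻¹) •
          (a - t)⁻¹ ^ (k + 1) • R t :=
        integral_integral_swap hF
    _ = _ := by
        rw [← integral_smul]
        congr 1
        ext1 t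
        have e : ∀ s : ℝ, (a - s)⁻¹ ^ (k + 1) * ((s - ε * I : ℂ) - t)⁻¹ =
            -((a - s)⁻¹ ^ (k + 1) * ((t + ε * I : ℂ) - s)⁻¹) := by
          intro s
          rw [← mul_neg, ← inv_neg]
          ring_nf
        have e' : a - ε * I - t = a - (t + ε * I) := by ring
        rw [integral_smul_const (fun s : ℝ => (a - s)⁻¹ ^ (k + 1) * ((s - ε * I : ℂ) - t)⁻¹)]
        simp_rw [e]
        rw [integral_neg, integral_inv_sub_pow_mul_of_im_pos ha (by rw [him']; exact hε), e',
          neg_mul, neg_neg, mul_smul]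

theorem integral_mul_self (hS : ResolventAt A a S) (ha : a.im < 0) {δ C : ℝ} (hδ : 0 < δ)
    (hR : ∀ s ε : ℝ, 0 ≤ ε → ε ≤ δ → ResolventAt A (s - ε * I) (R (s - ε * I))) {k : ℕ}
    (hC : ∀ s ε : ℝ, 0 ≤ ε → ε ≤ δ →
      ‖(a - s)⁻¹ ^ (k + 1) • R (s - ε * I)‖ ≤ C * (1 + s ^ 2)⁻¹) :
    (∫ s : ℝ, (a - s)⁻¹ ^ (k + 1) • R s) * (∫ s : ℝ, (a - s)⁻¹ ^ (k + 1) • R s) =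
      (2 * Real.pi * I) • (S ^ (k + 1) * ∫ s : ℝ, (a - s)⁻¹ ^ (k + 1) • R s) := by
  have hw : Continuous fun s : ℝ => (a - s)⁻¹ ^ (k + 1) := (continuous_inv_sub_ofReal ha.ne).pow _
  have hCi : Integrable fun s : ℝ => C * (1 + s ^ 2)⁻¹ := integrable_inv_one_add_sq.const_mul C
  have hR0 : ∀ s : ℝ, ResolventAt A s (R s) := fun s => by simpa using hR s 0 le_rfl hδ.le
  have hcε : ∀ ε : ℝ, 0 ≤ ε → ε ≤ δ → Continuous fun s : ℝ => R (s - ε * I) := fun ε h0 h1 =>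
    continuous_resolvent_comp (f := fun s : ℝ => (s - ε * I : ℂ)) (by fun_prop)
      fun s => hR s ε h0 h1
  have hiε : ∀ ε : ℝ, 0 ≤ ε → ε ≤ δ →
      Integrable fun s : ℝ => (a - s)⁻¹ ^ (k + 1) • R (s - ε * I) := fun ε h0 h1 =>
    hCi.mono' (hw.smul (hcε ε h0 h1)).aestronglyMeasurable (.of_forall fun s => hC s ε h0 h1)
  have hi : Integrable fun s : ℝ => (a - s)⁻¹ ^ (k + 1) • R s := by
    simpa using hiε 0 le_rfl hδ.le
  have hmem : ∀ᶠ ε : ℝ in 𝓝[>] 0, 0 < ε ∧ ε ≤ δ := by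
    filter_upwards [Ioc_mem_nhdsGT hδ] with ε h using h
  have hlim₁ : Tendsto (fun ε : ℝ => ∫ s : ℝ, (a - s)⁻¹ ^ (k + 1) • R (s - ε * I)) (𝓝[>] 0)
      (𝓝 (∫ s : ℝ, (a - s)⁻¹ ^ (k + 1) • R s)) := by
    refine tendsto_integral_filter_of_dominated_convergence _
      (hmem.mono fun ε h => (hiε ε h.1.le h.2).1)
      (hmem.mono fun ε h => .of_forall fun s => hC s ε h.1.le h.2) hCi (.of_forall fun s => ?_)
    refine ((hR0 s).tendsto_of_tendsto ?_ (hmem.mono fun ε h => hR s ε h.1.le h.2)).const_smul _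
    have : Continuous fun ε : ℝ => (s - ε * I : ℂ) := by fun_prop
    exact (this.tendsto' 0 _ (by simp)).mono_left nhdsWithin_le_nhds
  have him : ∀ ε : ℝ, (a - ε * I).im = a.im - ε := fun ε => by simp
  have hne : ∀ ε : ℝ, 0 ≤ ε → (a - ε * I).im ≠ 0 := fun ε h => by
    rw [him]
    exact (by linarith : a.im - ε < 0).ne
  have hlim₂ : Tendsto (fun ε : ℝ => (2 * Real.pi * I) •
      ∫ t : ℝ, (a - ε * I - t)⁻¹ ^ (k + 1) • (a - t)⁻¹ ^ (k + 1) • R t) (𝓝[>] 0)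
      (𝓝 ((2 * Real.pi * I) • ∫ t : ℝ, (a - t)⁻¹ ^ (k + 1) • (a - t)⁻¹ ^ (k + 1) • R t)) := by
    refine Tendsto.const_smul ?_ _
    refine tendsto_integral_filter_of_dominated_convergence
      (fun t => |a.im|⁻¹ ^ (k + 1) * ‖(a - t)⁻¹ ^ (k + 1) • R t‖)
      (hmem.mono fun ε h => ?_) (hmem.mono fun ε h => .of_forall fun t => ?_)
      (hi.norm.const_mul _) (.of_forall fun t => ?_)
    · exact ((continuous_inv_sub_ofReal (hne ε h.1.le)).pow _ |>.smul (hw.smul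
        (continuous_resolvent_comp continuous_ofReal hR0))).aestronglyMeasurable
    · rw [norm_smul, norm_pow]
      gcongr
      refine (norm_inv_sub_ofReal_le (hne ε h.1.le) t).trans ?_
      rw [him, abs_of_neg ha, abs_of_neg (by linarith)]
      exact inv_anti₀ (by linarith) (by linarith)
    · refine Tendsto.smul_const (Tendsto.pow (Tendsto.inv₀ ?_ (sub_ofReal_ne_zero ha.ne t)) _) _
      have : Continuous fun ε : ℝ => a - ε * I - t := by fun_prop
      exact (this.tendsto' 0 _ (by simp)).mono_left nhdsWithin_le_nhds
  have heq := tendsto_nhds_unique ((hlim₁.mul_const _).congr'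
    (hmem.mono fun ε h => integral_shift_mul_integral hR0 ha hi h.1 (fun s => hR s ε h.1.le h.2)
      (hiε ε h.1.le h.2))) hlim₂
  rw [heq, (hS.pow_mul_integral hR0 ha hi (k + 1)).2]
  simp_rw [smul_smul, ← pow_add]
  congr! 5
  ring

end ContourIntegrals

section Laplace

theorem integrableOn_exp_neg_mul_one_add_pow (m : ℕ) :
    IntegrableOn (fun t : ℝ => Real.exp (-t) * (1 + t ^ m)) (Set.Ioi 0) := by
  have h0 := Real.GammaIntegral_convergent (s := 1) one_pos
  have hm := Real.GammaIntegral_convergent (s := m + 1) (by positivity)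
  refine (h0.add hm).congr_fun (fun t _ => ?_) measurableSet_Ioi
  simp [mul_add, Real.rpow_natCast]

theorem norm_exp_neg_mul_ofReal (z : ℂ) (t : ℝ) : ‖Complex.exp (-z * t)‖ = Real.exp (-(z.re * t)) := by
  rw [Complex.norm_exp]
  simp

variable {V : Type*} [NormedAddCommGroup V] [NormedSpace ℂ V]

theorem continuousOn_exp_smul {h : ℝ → V} (hh : ContinuousOn h (Set.Ici 0)) (z : ℂ) :
    ContinuousOn (fun t : ℝ => Complex.exp (-z * t) • h t) (Set.Ici 0) :=
  (by fun_prop : Continuous fun t : ℝ => Complex.exp (-z * t)).continuousOn.smul hh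

theorem norm_exp_smul_le {h : ℝ → V} {m : ℕ} {M : ℝ} (hM : 0 ≤ M)
    (hb : ∀ t, 0 ≤ t → ‖h t‖ ≤ M * (1 + t ^ m)) {z : ℂ} (hz : 1 ≤ z.re) {t : ℝ} (ht : 0 < t) :
    ‖Complex.exp (-z * t) • h t‖ ≤ M * (Real.exp (-(z.re * t)) * (1 + (z.re * t) ^ m)) := by
  rw [norm_smul, norm_exp_neg_mul_ofReal]
  calc _ ≤ Real.exp (-(z.re * t)) * (M * (1 + t ^ m)) := by gcongr; exact hb t ht.le
    _ = M * (Real.exp (-(z.re * t)) * (1 + t ^ m)) := by ring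
    _ ≤ _ := by
      gcongr
      exact le_mul_of_one_le_left ht.le hz

theorem integrableOn_exp_smul {h : ℝ → V} {m : ℕ} {M : ℝ} (hM : 0 ≤ M)
    (hh : ContinuousOn h (Set.Ici 0))
    (hb : ∀ t, 0 ≤ t → ‖h t‖ ≤ M * (1 + t ^ m)) {z : ℂ} (hz : 1 ≤ z.re) :
    IntegrableOn (fun t : ℝ => Complex.exp (-z * t) • h t) (Set.Ioi 0) := by
  have hg := (integrableOn_Ioi_comp_mul_left_iff (fun t : ℝ => Real.exp (-t) * (1 + t ^ m)) 0
    (zero_lt_one.trans_le hz)).2 (by simpa using integrableOn_exp_neg_mul_one_add_pow m)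
  refine (hg.const_mul M).mono' ?_ ?_
  · exact ((continuousOn_exp_smul hh z).mono Set.Ioi_subset_Ici_self).aestronglyMeasurable
      measurableSet_Ioi
  · filter_upwards [ae_restrict_mem measurableSet_Ioi] with t ht
    exact norm_exp_smul_le hM hb hz ht

theorem norm_integral_exp_smul_le {h : ℝ → V} {m : ℕ} {M : ℝ} (hM : 0 ≤ M)
    (hb : ∀ t, 0 ≤ t → ‖h t‖ ≤ M * (1 + t ^ m)) {z : ℂ} (hz : 1 ≤ z.re) :
    ‖∫ t in Set.Ioi (0 : ℝ), Complex.exp (-z * t) • h t‖ ≤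
      M * (∫ t in Set.Ioi (0 : ℝ), Real.exp (-t) * (1 + t ^ m)) / z.re := by
  have hz0 := zero_lt_one.trans_le hz
  have hg := (integrableOn_Ioi_comp_mul_left_iff (fun t : ℝ => Real.exp (-t) * (1 + t ^ m)) 0
    hz0).2 (by simpa using integrableOn_exp_neg_mul_one_add_pow m)
  have hle := norm_integral_le_of_norm_le (hg.const_mul M)
    (f := fun t : ℝ => Complex.exp (-z * t) • h t) (by
      filter_upwards [ae_restrict_mem measurableSet_Ioi] with t ht
      exact norm_exp_smul_le hM hb hz ht)
  refine hle.trans_eq ?_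
  rw [integral_const_mul,
    integral_comp_mul_left_Ioi (fun t : ℝ => Real.exp (-t) * (1 + t ^ m)) 0 hz0, mul_zero,
    smul_eq_mul]
  ring

/-- Uniqueness for the Laplace transform of continuous functions. -/
theorem eq_zero_of_laplace_eq_zero [CompleteSpace V] {h : ℝ → V}
    (hh : ContinuousOn h (Set.Ici 0))
    (hi : IntegrableOn (fun t : ℝ => Complex.exp (-1 * t) • h t) (Set.Ioi 0))
    (hz : ∀ z : ℂ, z.re = 1 → ∫ t in Set.Ioi (0 : ℝ), Complex.exp (-z * t) • h t = 0)
    {t : ℝ} (ht : 0 ≤ t) : h t = 0 := by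
  set f : ℝ → V := (Set.Ioi 0).indicator fun t : ℝ => Complex.exp (-1 * t) • h t with hf
  have hfi : Integrable f := (integrable_indicator_iff measurableSet_Ioi).2 hi
  have hF : FourierTransform.fourier f = 0 := by
    ext ξ
    rw [Real.fourier_real_eq_integral_exp_smul, Pi.zero_apply,
      ← hz (1 + 2 * Real.pi * ξ * I) (by simp), ← integral_indicator measurableSet_Ioi]
    congr 1
    ext1 s
    by_cases hs : s ∈ Set.Ioi (0 : ℝ)
    · rw [hf, Set.indicator_of_mem hs, Set.indicator_of_mem hs, smul_smul, ← Complex.exp_add]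
      congr 2
      push_cast
      ring
    · rw [hf, Set.indicator_of_notMem hs, Set.indicator_of_notMem hs, smul_zero]
  have hpos : ∀ v ∈ Set.Ioi (0 : ℝ), h v = 0 := by
    intro v hv
    have hev : (fun t : ℝ => Complex.exp (-1 * t) • h t) =ᶠ[𝓝 v] f := by
      filter_upwards [Ioi_mem_nhds hv] with s hs
      rw [hf, Set.indicator_of_mem hs]
    have hc : ContinuousAt f v :=
      ((continuousOn_exp_smul hh 1).continuousAt (Ici_mem_nhds hv)).congr hev
    have h1 := hfi.fourierInv_fourier_eq (by rw [hF]; exact integrable_zero _ _ _) hc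
    rw [hF, ← hev.self_of_nhds, Real.fourierInv_eq] at h1
    simpa [eq_comm] using h1
  rcases ht.eq_or_lt with rfl | ht
  · have h1 : Tendsto h (𝓝[>] 0) (𝓝 (h 0)) :=
      (hh 0 Set.self_mem_Ici).tendsto.mono_left (nhdsWithin_mono _ Set.Ioi_subset_Ici_self)
    refine tendsto_nhds_unique h1 (tendsto_const_nhds.congr' ?_)
    filter_upwards [self_mem_nhdsWithin] with v hv using (hpos v hv).symm
  · exact hpos t ht

end Laplace

section Generation

variable {A : G →ₗ.[ℂ] G} {n m : ℕ} {M : ℝ} {Sp Sm : ℝ → G →L[ℂ] G} {a μ : ℂ}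
  {R : ℂ → G →L[ℂ] G} {S : ℝ → G →L[ℂ] G} {Q : G →L[ℂ] G}

theorem norm_apply_le_of_norm_le (hb : ∀ t : ℝ, 0 ≤ t → ‖S t‖ ≤ M * (1 + t ^ m)) (x : G) {t : ℝ}
    (ht : 0 ≤ t) : ‖S t x‖ ≤ M * ‖x‖ * (1 + t ^ m) := by
  calc ‖S t x‖ ≤ ‖S t‖ * ‖x‖ := (S t).le_opNorm x
    _ ≤ M * (1 + t ^ m) * ‖x‖ := by gcongr; exact hb t ht
    _ = _ := by ring

theorem commute_of_laplace [CompleteSpace G] (hM : 0 ≤ M)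
    (hc : ∀ x : G, ContinuousOn (fun t : ℝ => S t x) (Set.Ici 0))
    (hb : ∀ t : ℝ, 0 ≤ t → ‖S t‖ ≤ M * (1 + t ^ m))
    (hL : ∀ z : ℂ, z.re = 1 → ∃ P : G →L[ℂ] G, Commute Q P ∧
      ∀ x, P x = z ^ n • ∫ t in Set.Ioi (0 : ℝ), Complex.exp (-z * t) • S t x)
    {t : ℝ} (ht : 0 ≤ t) : Commute Q (S t) := by
  have hint : ∀ x, ∀ z : ℂ, z.re = 1 →
      IntegrableOn (fun t : ℝ => Complex.exp (-z * t) • S t x) (Set.Ioi 0) := fun x z hz =>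
    integrableOn_exp_smul (by positivity : 0 ≤ M * ‖x‖) (hc x)
      (fun t ht => norm_apply_le_of_norm_le hb x ht) hz.ge
  ext x
  rw [mul_apply_eq_comp, mul_apply_eq_comp, ← sub_eq_zero]
  have hsub : ∀ z : ℂ, ∀ t : ℝ, Complex.exp (-z * t) • (Q (S t x) - S t (Q x)) =
      Q (Complex.exp (-z * t) • S t x) - Complex.exp (-z * t) • S t (Q x) := fun z t => by
    rw [smul_sub, map_smul]
  refine eq_zero_of_laplace_eq_zero (h := fun t => Q (S t x) - S t (Q x))
    ((Q.continuous.comp_continuousOn (hc x)).sub (hc (Q x))) ?_ (fun z hz => ?_) ht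
  · simp_rw [hsub]
    exact (Q.integrable_comp (hint x 1 one_re)).sub (hint (Q x) 1 one_re)
  · simp_rw [hsub]
    rw [integral_sub (Q.integrable_comp (hint x z hz)) (hint (Q x) z hz),
      Q.integral_comp_comm (hint x z hz)]
    obtain ⟨P, hQP, hP⟩ := hL z hz
    have hz0 : z ^ n ≠ 0 := pow_ne_zero _ (by rintro rfl; simp at hz)
    have h1 : z ^ n • Q (∫ t in Set.Ioi (0 : ℝ), Complex.exp (-z * t) • S t x) =
        z ^ n • ∫ t in Set.Ioi (0 : ℝ), Complex.exp (-z * t) • S t (Q x) := by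
      rw [← map_smul, ← hP, ← hP, ← mul_apply_eq_comp, hQP.eq, mul_apply_eq_comp]
    rw [smul_right_injective _ hz0 h1, sub_self]

theorem Generates.commute [CompleteSpace G] (hgen : Generates A n m M Sp Sm) (hM : 0 ≤ M)
    (hQ : ResolventAt A μ Q) {t : ℝ} (ht : 0 ≤ t) : Commute Q (Sp t) ∧ Commute Q (Sm t) := by
  obtain ⟨hcp, hcm, hbp, hbm, hL⟩ := hgen
  constructor
  · refine commute_of_laplace (n := n) hM hcp hbp (fun z hz => ?_) ht
    obtain ⟨⟨P, hP, hP'⟩, -⟩ := hL z (hz ▸ one_pos)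
    exact ⟨P, hQ.commute hP, hP'⟩
  · refine commute_of_laplace (n := n) hM hcm hbm (fun z hz => ?_) ht
    obtain ⟨-, P, hP, hP'⟩ := hL z (hz ▸ one_pos)
    exact ⟨-P, (hQ.commute hP).neg_right, hP'⟩

theorem norm_le_of_laplace (hM : 0 ≤ M) (hb : ∀ t : ℝ, 0 ≤ t → ‖S t‖ ≤ M * (1 + t ^ m)) {z : ℂ}
    (hz : 1 ≤ z.re)
    (hQ : ∀ x, Q x = z ^ n • ∫ t in Set.Ioi (0 : ℝ), Complex.exp (-z * t) • S t x) :
    ‖Q‖ ≤ ‖z‖ ^ n * (M * (∫ t in Set.Ioi (0 : ℝ), Real.exp (-t) * (1 + t ^ m)) / z.re) := by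
  have hK : 0 ≤ ∫ t in Set.Ioi (0 : ℝ), Real.exp (-t) * (1 + t ^ m) :=
    setIntegral_nonneg measurableSet_Ioi fun t (ht : 0 < t) => by positivity
  have hz0 : 0 ≤ z.re := zero_le_one.trans hz
  refine Q.opNorm_le_bound (by positivity) fun x => ?_
  rw [hQ, norm_smul, norm_pow, mul_assoc]
  gcongr
  refine (norm_integral_exp_smul_le (by positivity : 0 ≤ M * ‖x‖)
    (fun t ht => norm_apply_le_of_norm_le hb x ht) hz).trans_eq ?_
  ring

theorem Generates.norm_le (hgen : Generates A n m M Sp Sm) (hM : 0 ≤ M) (hQ : ResolventAt A μ Q)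
    (hμ : 1 ≤ |μ.re|) :
    ‖Q‖ ≤ ‖μ‖ ^ n * (M * (∫ t in Set.Ioi (0 : ℝ), Real.exp (-t) * (1 + t ^ m)) / |μ.re|) := by
  obtain ⟨-, -, hbp, hbm, hL⟩ := hgen
  rcases le_abs'.1 hμ with h | h
  · obtain ⟨-, P, hP, hP'⟩ := hL (-μ) (by rw [neg_re]; linarith)
    rw [neg_neg] at hP
    rw [hP.unique hQ] at hP'
    have := norm_le_of_laplace (Q := -Q) hM hbm (by rw [neg_re]; linarith) hP'
    rwa [norm_neg, norm_neg, neg_re, ← abs_of_neg (by linarith : μ.re < 0)] at this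
  · obtain ⟨⟨P, hP, hP'⟩, -⟩ := hL μ (by linarith)
    rw [hP.unique hQ] at hP'
    have := norm_le_of_laplace (Q := Q) hM hbp h hP'
    rwa [← abs_of_pos (by linarith : 0 < μ.re)] at this

theorem Generates.exists_strip_bound (hgen : Generates A n m M Sp Sm) (hnm : n ≤ m) (hM : 0 ≤ M)
    (ha : a.im < 0) (ha' : a.re = 0) {δ : ℝ} (hδ : 0 ≤ δ)
    (hR : ∀ s ε : ℝ, 0 ≤ ε → ε ≤ δ → ResolventAt A (s - ε * I) (R (s - ε * I))) :
    ∃ C, ∀ s ε : ℝ, 0 ≤ ε → ε ≤ δ →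
      ‖(a - s)⁻¹ ^ (m + 1) • R (s - ε * I)‖ ≤ C * (1 + s ^ 2)⁻¹ := by
  obtain ⟨B, hB⟩ := (isCompact_univ
    (X := Set.Icc (-1 : ℝ) 1 × Set.Icc (0 : ℝ) δ)).exists_bound_of_continuousOn
    (f := fun p => (a - (p.1 : ℝ))⁻¹ ^ (m + 1) • R ((p.1 : ℝ) - (p.2 : ℝ) * I))
    (((((continuous_inv_sub_ofReal ha.ne).comp (by fun_prop)).pow _).smul
      (continuous_resolvent_comp (A := A) (f := fun p : Set.Icc (-1 : ℝ) 1 × Set.Icc (0 : ℝ) δ =>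
        ((p.1 : ℝ) - (p.2 : ℝ) * I : ℂ)) (by fun_prop)
        fun p => hR p.1 p.2 p.2.2.1 p.2.2.2)).continuousOn)
  set K : ℝ := ∫ t in Set.Ioi (0 : ℝ), Real.exp (-t) * (1 + t ^ m) with hKdef
  have hK : 0 ≤ K := setIntegral_nonneg measurableSet_Ioi fun t (ht : 0 < t) => by positivity
  have hK' : 0 ≤ (1 + δ) ^ n * (M * K) := by positivity
  refine ⟨2 * (|B| + (1 + δ) ^ n * (M * K)), fun s ε hε hεδ => ?_⟩
  rw [← div_eq_mul_inv, le_div_iff₀ (by positivity)]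
  rcases le_or_gt |s| 1 with hs | hs
  · have h1 := hB (⟨s, abs_le.1 hs⟩, ⟨ε, hε, hεδ⟩) (Set.mem_univ _)
    have h2 : s ^ 2 ≤ 1 := (sq_le_one_iff_abs_le_one s).2 hs
    have h3 := le_abs_self B
    have h4 := abs_nonneg B
    simp only at h1
    calc _ ≤ |B| * (1 + 1) := by
          gcongr
          exact h1.trans h3
      _ ≤ _ := by linarith
  · have hs0 : 0 < |s| := one_pos.trans hs
    have hre : (s - ε * I : ℂ).re = s := by simp
    have h1 := hgen.norm_le hM (hR s ε hε hεδ) (by rw [hre]; exact hs.le)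
    rw [hre, ← hKdef] at h1
    have h2 : ‖(s - ε * I : ℂ)‖ ≤ (1 + δ) * |s| := by
      calc ‖(s - ε * I : ℂ)‖ ≤ |s| + ε := by
            refine (norm_sub_le _ _).trans_eq ?_
            simp [abs_of_nonneg hε]
        _ ≤ |s| + δ * |s| := by nlinarith
        _ = _ := by ring
    have h3 : ‖(a - s)⁻¹‖ ≤ |s|⁻¹ := by
      rw [norm_inv]
      refine inv_anti₀ hs0 ?_
      have := Complex.abs_re_le_norm (a - s)
      simpa [ha'] using this
    have h4 : |s| ^ n ≤ |s| ^ m := pow_le_pow_right₀ hs.le hnm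
    rw [norm_smul, norm_pow]
    calc _ ≤ |s|⁻¹ ^ (m + 1) * (((1 + δ) * |s|) ^ n * (M * K / |s|)) * (s ^ 2 + s ^ 2) := by
          have h5 : 1 ≤ s ^ 2 := by rw [← sq_abs]; exact one_le_pow₀ hs.le
          gcongr
          refine h1.trans ?_
          gcongr
      _ = |s| ^ n * ((|s| ^ m)⁻¹ * (2 * ((1 + δ) ^ n * (M * K)))) := by
          have hs1 := hs0.ne'
          rw [← sq_abs s, mul_pow, inv_pow]
          field_simp
          ring
      _ ≤ |s| ^ m * ((|s| ^ m)⁻¹ * (2 * ((1 + δ) ^ n * (M * K)))) := by gcongr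
      _ = 2 * ((1 + δ) ^ n * (M * K)) := by
          rw [← mul_assoc, mul_inv_cancel₀ (by positivity), one_mul]
      _ ≤ _ := by linarith [abs_nonneg B]

theorem Generates.part (hgen : Generates A n m M Sp Sm) {F : Submodule ℂ G} [CompleteSpace F]
    [CompleteSpace G] (hF : ∀ z Q, ResolventAt A z Q → ∀ x ∈ F, Q x ∈ F)
    {Spf Smf : ℝ → F →L[ℂ] F} (hp : ∀ t, 0 ≤ t → ∀ x, (Spf t x : G) = Sp t x)
    (hm : ∀ t, 0 ≤ t → ∀ x, (Smf t x : G) = Sm t x) :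
    Generates (partOf A F) n m M Spf Smf := by
  obtain ⟨hcp, hcm, hbp, hbm, hL⟩ := hgen
  have hcont : ∀ {S : ℝ → G →L[ℂ] G} {Sf : ℝ → F →L[ℂ] F},
      (∀ t, 0 ≤ t → ∀ x, (Sf t x : G) = S t x) →
      (∀ x : G, ContinuousOn (fun t : ℝ => S t x) (Set.Ici 0)) →
      ∀ x : F, ContinuousOn (fun t : ℝ => Sf t x) (Set.Ici 0) := by
    intro S Sf h hc x
    rw [continuousOn_iff_continuous_domRestrict, continuous_induced_rng]
    exact (hc x).domRestrict.congr fun t => (h t t.2 x).symm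
  have hnorm : ∀ {S : ℝ → G →L[ℂ] G} {Sf : ℝ → F →L[ℂ] F},
      (∀ t, 0 ≤ t → ∀ x, (Sf t x : G) = S t x) → (∀ t : ℝ, 0 ≤ t → ‖S t‖ ≤ M * (1 + t ^ m)) →
      ∀ t : ℝ, 0 ≤ t → ‖Sf t‖ ≤ M * (1 + t ^ m) := by
    intro S Sf h hb t ht
    refine le_trans ?_ (hb t ht)
    refine (Sf t).opNorm_le_bound (norm_nonneg _) fun x => ?_
    rw [← Submodule.norm_coe, h t ht]
    exact (S t).le_opNorm x
  have hint : ∀ {S : ℝ → G →L[ℂ] G} {Sf : ℝ → F →L[ℂ] F},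
      (∀ t, 0 ≤ t → ∀ x, (Sf t x : G) = S t x) → ∀ (z : ℂ) (x : F),
      ((∫ t in Set.Ioi (0 : ℝ), Complex.exp (-z * t) • Sf t x : F) : G) =
        ∫ t in Set.Ioi (0 : ℝ), Complex.exp (-z * t) • S t x := by
    intro S Sf h z x
    refine (F.subtypeₗᵢ.integral_comp_comm _).symm.trans
      (setIntegral_congr_fun measurableSet_Ioi fun t (ht : 0 < t) => ?_)
    simp [h t ht.le]
  refine ⟨hcont hp hcp, hcont hm hcm, hnorm hp hbp, hnorm hm hbm, fun z hz => ?_⟩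
  obtain ⟨⟨P, hP, hP'⟩, Q, hQ, hQ'⟩ := hL z hz
  refine ⟨⟨_, hP.part (hF _ _ hP), fun x => Subtype.ext ?_⟩,
    ⟨_, hQ.part (hF _ _ hQ), fun x => Subtype.ext ?_⟩⟩
  · rw [coe_restrictTo_apply, Submodule.coe_smul, hint hp, hP']
  · rw [Submodule.coe_neg, coe_restrictTo_apply, Submodule.coe_smul, hint hm, hQ']

end Generation

section Separation

variable {A : G →ₗ.[ℂ] G} {a μ : ℂ} {R : ℂ → G →L[ℂ] G} {S T : G →L[ℂ] G}
  {F F₁ F₂ : Submodule ℂ G}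

theorem tendsto_const_add_ofReal : Tendsto (fun t : ℝ => μ + t) (𝓝 0) (𝓝 μ) :=
  Continuous.tendsto' (by fun_prop) _ _ (by simp)

theorem tendsto_integral_inv_sub_mul_smul {f : ℝ → ℂ} (hμ : μ.im ≠ 0)
    (hi : Integrable fun s : ℝ => f s • R s) :
    Tendsto (fun t : ℝ => ∫ s : ℝ, (f s * (μ + t - s)⁻¹) • R s) (𝓝 0)
      (𝓝 (∫ s : ℝ, (f s * (μ - s)⁻¹) • R s)) := by
  have him : ∀ t : ℝ, (μ + t : ℂ).im = μ.im := fun t => by simp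
  refine tendsto_integral_filter_of_dominated_convergence (fun s => |μ.im|⁻¹ * ‖f s • R s‖)
    (.of_forall fun t => ?_) (.of_forall fun t => .of_forall fun s => ?_) (hi.norm.const_mul _)
    (.of_forall fun s => ?_)
  · exact (integrable_inv_sub_mul_smul (by rwa [him]) hi).aestronglyMeasurable
  · rw [mul_comm, mul_smul, norm_smul]
    gcongr
    rw [← him t]
    exact norm_inv_sub_ofReal_le (by rwa [him]) s
  · exact (((tendsto_const_add_ofReal.sub_const (s : ℂ)).inv₀ (sub_ofReal_ne_zero hμ s)).const_mul _).smul_const _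

/-- A point of the imaginary axis is in the resolvent set of the part in `F` as soon as the
resolvent, restricted to `F`, converges along the horizontal line through this point. -/
theorem mem_resolventSet_partOf_of_re_eq_zero (hA : IsClosed (A.graph : Set (G × G)))
    (hF : IsClosed (F : Set G)) (hR : ∀ z : ℂ, z.re ≠ 0 → ResolventAt A z (R z))
    (hRF : ∀ z : ℂ, z.re ≠ 0 → ∀ x ∈ F, R z x ∈ F) (hμ : μ.re = 0) {Q : ℝ → G →L[ℂ] G}
    (hQ : Tendsto Q (𝓝[≠] 0) (𝓝 S)) (hRQ : ∀ t : ℝ, t ≠ 0 → ∀ x ∈ F, Q t x = R (μ + t) x) :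
    μ ∈ resolventSet (partOf A F) := by
  have hre : ∀ᶠ t : ℝ in 𝓝[≠] 0, (μ + t : ℂ).re ≠ 0 := by
    filter_upwards [self_mem_nhdsWithin] with t ht
    simpa [hμ] using ht
  refine mem_resolventSet_partOf_of_tendsto (R := S) hA hF (hre.mono fun t ht => hR _ ht)
    (hre.mono fun t ht => hRF _ ht) (tendsto_const_add_ofReal.mono_left nhdsWithin_le_nhds)
    fun x hx => ?_
  refine (((continuous_eval_const x).tendsto S).comp hQ).congr' ?_
  filter_upwards [self_mem_nhdsWithin] with t ht using hRQ t ht x hx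

theorem apply_mem_ker_of_commute (h : Commute S T) {x : G} (hx : x ∈ T.ker) : S x ∈ T.ker := by
  rw [LinearMap.mem_ker] at hx ⊢
  change T (S x) = 0
  rw [← mul_apply_eq_comp, ← h.eq, mul_apply_eq_comp]
  exact (congrArg S hx).trans (map_zero S)

theorem spectrumSet_partOf_eq {σ₁ σ₂ : Set ℂ} (hσ : spectrumSet A = σ₁ ∪ σ₂)
    (hF : ∀ z Q, ResolventAt A z Q → ∀ x ∈ F₁, Q x ∈ F₁)
    (h₁ : σ₂ ⊆ resolventSet (partOf A F₁)) (h₂ : σ₁ ⊆ resolventSet (partOf A F₂))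
    (hA : resolventSet (partOf A F₁) ∩ resolventSet (partOf A F₂) ⊆ resolventSet A) :
    spectrumSet (partOf A F₁) = σ₁ := by
  refine subset_antisymm (fun z hz => ?_) fun z hz hz' => ?_
  · have h : z ∈ spectrumSet A := fun ⟨Q, hQ⟩ => hz ⟨_, hQ.part (hF z Q hQ)⟩
    rw [hσ] at h
    exact h.resolve_right fun h' => hz (h₁ h')
  · have h : z ∈ spectrumSet A := hσ ▸ Or.inl hz
    exact h (hA ⟨hz', h₂ hz⟩)

variable [CompleteSpace G]

theorem mem_resolventSet_partOf_of_im_pos (hA : IsClosed (A.graph : Set (G × G)))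
    (hF : IsClosed (F : Set G)) (hR : ∀ s : ℝ, ResolventAt A s (R s))
    (hR' : ∀ z : ℂ, z.re ≠ 0 → ResolventAt A z (R z))
    (hRF : ∀ z : ℂ, z.re ≠ 0 → ∀ x ∈ F, R z x ∈ F) (ha : a.im < 0) {k : ℕ}
    (hi : Integrable fun s : ℝ => (a - s)⁻¹ ^ (k + 1) • R s)
    (hJ : ∀ x ∈ F, (∫ s : ℝ, (a - s)⁻¹ ^ (k + 1) • R s) x = 0) (hμ : 0 < μ.im)
    (hμ' : μ.re = 0) : μ ∈ resolventSet (partOf A F) := by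
  refine mem_resolventSet_partOf_of_re_eq_zero hA hF hR' hRF hμ'
    ((((((tendsto_const_add_ofReal (μ := μ)).const_sub a).pow (k + 1)).smul
      (tendsto_integral_inv_sub_mul_smul hμ.ne' hi)).const_smul
        (-(2 * Real.pi * I)⁻¹)).mono_left nhdsWithin_le_nhds) fun t ht x hx => ?_
  have him : 0 < (μ + t : ℂ).im := by simpa using hμ
  have h := congrArg (fun Q : G →L[ℂ] G => Q x)
    ((hR' (μ + t) (by simpa [hμ'] using ht)).mul_integral_of_im_pos hR ha him hi)
  simp only [mul_apply_eq_comp, add_apply, hJ x hx, map_zero] at h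
  have h0 : (a - (μ + t)) ^ (k + 1) ≠ 0 :=
    pow_ne_zero _ fun h => by linarith [congrArg Complex.im (sub_eq_zero.1 h)]
  rw [smul_apply, smul_apply, eq_neg_of_add_eq_zero_left h.symm, smul_apply, mul_smul, inv_pow,
    smul_neg, smul_neg, neg_smul, neg_neg, smul_comm (2 * Real.pi * I : ℂ), smul_inv_smul₀ h0,
    inv_smul_smul₀ Complex.two_pi_I_ne_zero]

theorem mem_resolventSet_partOf_of_im_neg (hA : IsClosed (A.graph : Set (G × G)))
    (hF : IsClosed (F : Set G)) (hR : ∀ s : ℝ, ResolventAt A s (R s))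
    (hR' : ∀ z : ℂ, z.re ≠ 0 → ResolventAt A z (R z))
    (hRF : ∀ z : ℂ, z.re ≠ 0 → ∀ x ∈ F, R z x ∈ F) (ha : a.im < 0) (hS : ResolventAt A a S) {k : ℕ}
    (hi : Integrable fun s : ℝ => (a - s)⁻¹ ^ (k + 1) • R s)
    (hJ : ∀ x ∈ F, (∫ s : ℝ, (a - s)⁻¹ ^ (k + 1) • R s) x =
      (2 * Real.pi * I : ℂ) • (S ^ (k + 1)) x) (hμ : μ.im < 0)
    (hμ' : μ.re = 0) : μ ∈ resolventSet (partOf A F) := by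
  have hlim := (tendsto_const_add_ofReal (μ := μ)).const_sub a
  refine mem_resolventSet_partOf_of_re_eq_zero hA hF hR' hRF hμ'
    (((tendsto_finsetSum (Finset.range (k + 1)) fun j _ => (hlim.pow j).smul_const (S ^ (j + 1))).add
      ((hlim.pow (k + 1)).smul ((tendsto_integral_inv_sub_mul_smul hμ.ne hi).const_smul
        (2 * Real.pi * I : ℂ)⁻¹))).mono_left nhdsWithin_le_nhds) fun t ht x hx => ?_
  have him : (μ + t : ℂ).im < 0 := by simpa using hμ
  have hμt := hR' (μ + t) (by simpa [hμ'] using ht)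
  have h := congrArg (fun Q : G →L[ℂ] G => Q x) (hμt.mul_integral_of_im_neg hR ha him hi)
  simp only [mul_apply_eq_comp, hJ x hx, map_smul] at h
  conv_rhs => rw [hμt.eq_sum_add hS (k + 1)]
  rw [add_apply, add_apply, smul_apply, smul_apply, smul_apply, ← h, mul_apply_eq_comp,
    inv_smul_smul₀ Complex.two_pi_I_ne_zero]

variable {n m : ℕ} {M : ℝ} {Sp Sm : ℝ → G →L[ℂ] G}

theorem Generates.exists_restriction (hgen : Generates A n m M Sp Sm)
    (hFc : IsClosed (F : Set G)) (hF : ∀ z Q, ResolventAt A z Q → ∀ x ∈ F, Q x ∈ F)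
    (hSF : ∀ t : ℝ, 0 ≤ t → ∀ x ∈ F, Sp t x ∈ F ∧ Sm t x ∈ F) :
    ∃ (B : F →ₗ.[ℂ] F) (Spf Smf : ℝ → F →L[ℂ] F), IsPartOf A F B ∧
      (∀ t : ℝ, 0 ≤ t → ∀ x : F, (Spf t x : G) = Sp t x ∧ (Smf t x : G) = Sm t x) ∧
      Generates B n m M Spf Smf ∧ B = partOf A F := by
  have := hFc.completeSpace_coe
  have hp : ∀ t, 0 ≤ t → ∀ x : F, (restrictTo (Sp (max t 0))
      (fun x hx => (hSF _ (le_max_right t 0) x hx).1) x : G) = Sp t x := fun t ht x => by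
    rw [coe_restrictTo_apply, max_eq_left ht]
  have hm : ∀ t, 0 ≤ t → ∀ x : F, (restrictTo (Sm (max t 0))
      (fun x hx => (hSF _ (le_max_right t 0) x hx).2) x : G) = Sm t x := fun t ht x => by
    rw [coe_restrictTo_apply, max_eq_left ht]
  exact ⟨_, _, _, isPartOf_partOf, fun t ht x => ⟨hp t ht x, hm t ht x⟩, hgen.part hF hp hm, rfl⟩

end Separation

/-- Separation theorem: if `A` generates an `n`-times integrated group
`(Sp, Sm)` bounded by `M (1 + |t| ^ m)` (`m ≥ n`) with discrete spectrum
`σ(A) = {iλ_k : k ∈ ℤ, k ≠ 0}` as in the spectral assumption, then there are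
closed subspaces `E₋`, `E₊` with trivial intersection whose sum contains
`D(A^(m+1))`, invariant under the integrated group, such that the part of `A`
in `E₋` (resp. `E₊`) generates an `n`-times integrated group bounded by
`M' (1 + |t| ^ m)` given by the restrictions of `Sp, Sm`, with spectrum
`σ⁻ = {iλ_k : k ≤ -1}` (resp. `σ⁺ = {iλ_k : k ≥ 1}`). -/
theorem separation_theorem
    {E : Type*} [NormedAddCommGroup E] [NormedSpace ℂ E] [CompleteSpace E]
    (A : E →ₗ.[ℂ] E)
    (hAclosed : IsClosed (A.graph : Set (E × E)))
    (hAdense : Dense (A.domain : Set E))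
    (n m : ℕ) (hnm : n ≤ m) (M : ℝ) (hM : 0 < M)
    (Sp Sm : ℝ → E →L[ℂ] E) (hgen : Generates A n m M Sp Sm)
    (lam : ℤ → ℝ)
    (hmono : ∀ j k : ℤ, j ≠ 0 → k ≠ 0 → j < k → lam j < lam k)
    (hpos : ∀ k : ℤ, 0 < k → 0 < lam k)
    (hneg : ∀ k : ℤ, k < 0 → lam k < 0)
    (hspec : spectrumSet A = {z : ℂ | ∃ k : ℤ, k ≠ 0 ∧ z = Complex.I * (lam k : ℂ)})
    (hiso : ∀ k : ℤ, k ≠ 0 → ∃ ε : ℝ, 0 < ε ∧ ∀ z ∈ spectrumSet A,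
      z ∈ Metric.closedBall (Complex.I * (lam k : ℂ)) ε → z = Complex.I * (lam k : ℂ)) :
    ∃ Em Ep : Submodule ℂ E,
      IsClosed (Em : Set E) ∧ IsClosed (Ep : Set E) ∧
      Em ⊓ Ep = ⊥ ∧
      (∀ x : E, InDomPow A (m + 1) x → ∃ a ∈ Em, ∃ b ∈ Ep, x = a + b) ∧
      (∀ t : ℝ, 0 ≤ t →
        (∀ x ∈ Em, Sp t x ∈ Em ∧ Sm t x ∈ Em) ∧
        (∀ x ∈ Ep, Sp t x ∈ Ep ∧ Sm t x ∈ Ep)) ∧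
      ∃ M' : ℝ, 0 < M' ∧
        (∃ (Am : ↥Em →ₗ.[ℂ] ↥Em) (Spm Smm : ℝ → ↥Em →L[ℂ] ↥Em),
          IsPartOf A Em Am ∧
          (∀ t : ℝ, 0 ≤ t → ∀ x : ↥Em,
            ((Spm t x : E) = Sp t (x : E) ∧ (Smm t x : E) = Sm t (x : E))) ∧
          Generates Am n m M' Spm Smm ∧
          spectrumSet Am = {z : ℂ | ∃ k : ℤ, k ≤ -1 ∧ z = Complex.I * (lam k : ℂ)}) ∧
        (∃ (Ap : ↥Ep →ₗ.[ℂ] ↥Ep) (Spp Smp : ℝ → ↥Ep →L[ℂ] ↥Ep),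
          IsPartOf A Ep Ap ∧
          (∀ t : ℝ, 0 ≤ t → ∀ x : ↥Ep,
            ((Spp t x : E) = Sp t (x : E) ∧ (Smp t x : E) = Sm t (x : E))) ∧
          Generates Ap n m M' Spp Smp ∧
          spectrumSet Ap = {z : ℂ | ∃ k : ℤ, 1 ≤ k ∧ z = Complex.I * (lam k : ℂ)}) := by
  have hσ : spectrumSet A = {z : ℂ | ∃ k : ℤ, k ≤ -1 ∧ z = Complex.I * (lam k : ℂ)} ∪
      {z : ℂ | ∃ k : ℤ, 1 ≤ k ∧ z = Complex.I * (lam k : ℂ)} := by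
    rw [hspec]
    ext z
    constructor
    · rintro ⟨k, hk, rfl⟩
      rcases lt_or_gt_of_ne hk with h | h
      · exact Or.inl ⟨k, by lia, rfl⟩
      · exact Or.inr ⟨k, h, rfl⟩
    · rintro (⟨k, hk, rfl⟩ | ⟨k, hk, rfl⟩)
      · exact ⟨k, by lia, rfl⟩
      · exact ⟨k, by lia, rfl⟩
  have hle : ∀ k : ℤ, k ≤ -1 → lam k ≤ lam (-1) := fun k hk => by
    rcases hk.eq_or_lt with rfl | h
    · exact le_rfl
    · exact (hmono k (-1) (by lia) (by lia) h).le
  have hlam := hneg (-1) (by lia)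
  have hoff : ∀ z : ℂ, (z.re ≠ 0 ∨ lam (-1) < z.im ∧ z.im ≤ 0) → z ∈ resolventSet A := by
    intro z hz
    by_contra h
    obtain ⟨k, hk, rfl⟩ : z ∈ {z : ℂ | ∃ k : ℤ, k ≠ 0 ∧ z = Complex.I * (lam k : ℂ)} := hspec ▸ h
    simp only [I_mul_re, I_mul_im, ofReal_im, ofReal_re, neg_zero, ne_eq, not_true_eq_false,
      false_or] at hz
    rcases lt_or_gt_of_ne hk with h | h
    · exact absurd (hle k (by lia)) hz.1.not_ge
    · exact absurd (hpos k h) hz.2.not_gt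
  choose! R hR using fun (z : ℂ) (hz : z ∈ resolventSet A) => hz
  set a : ℂ := (lam (-1) / 2 : ℝ) * I with ha
  have ha_im : a.im < 0 := by simp [ha]; linarith
  have ha_re : a.re = 0 := by simp [ha]
  have hRa := hR a (hoff a (Or.inr (by simp [ha]; constructor <;> linarith)))
  have hδ : 0 < -lam (-1) / 2 := by linarith
  have hstrip : ∀ s ε : ℝ, 0 ≤ ε → ε ≤ -lam (-1) / 2 →
      ResolventAt A (s - ε * I) (R (s - ε * I)) := fun s ε h0 h1 =>
    hR _ (hoff _ (Or.inr (by simp; constructor <;> linarith)))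
  have hreal : ∀ s : ℝ, ResolventAt A s (R s) := fun s => by simpa using hstrip s 0 le_rfl hδ.le
  have hRre : ∀ z : ℂ, z.re ≠ 0 → ResolventAt A z (R z) := fun z hz => hR z (hoff z (Or.inl hz))
  obtain ⟨C, hC⟩ := hgen.exists_strip_bound hnm hM.le ha_im ha_re hδ.le hstrip
  have hi : Integrable fun s : ℝ => (a - s)⁻¹ ^ (m + 1) • R s := by
    refine (integrable_inv_one_add_sq.const_mul C).mono'
      (((continuous_inv_sub_ofReal ha_im.ne).pow _).smul
        (continuous_resolvent_comp continuous_ofReal hreal)).aestronglyMeasurable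
      (.of_forall fun s => ?_)
    simpa using hC s 0 le_rfl hδ.le
  have hJJ := integral_mul_self hRa ha_im hδ hstrip hC
  have hcomm : ∀ Q : E →L[ℂ] E, (∀ s : ℝ, Commute Q (R s)) →
      Commute Q (∫ s : ℝ, (a - s)⁻¹ ^ (m + 1) • R s) := fun Q hQ =>
    commute_integral fun s => (hQ s).smul_right _
  set J : E →L[ℂ] E := ∫ s : ℝ, (a - s)⁻¹ ^ (m + 1) • R s with hJ
  set T : E →L[ℂ] E := (2 * Real.pi * I : ℂ)⁻¹ • J with hT
  set W : E →L[ℂ] E := R a ^ (m + 1) with hW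
  have hJT : J = (2 * Real.pi * I : ℂ) • T := (smul_inv_smul₀ Complex.two_pi_I_ne_zero J).symm
  have hTT : T * T = W * T := by
    rw [hT, smul_mul_smul_comm, hJJ, mul_smul_comm, smul_smul, mul_assoc,
      inv_mul_cancel₀ Complex.two_pi_I_ne_zero, mul_one]
  have hcommT : ∀ {z Q}, ResolventAt A z Q → Commute Q T ∧ Commute Q (W - T) := fun {z Q} hQ => by
    have h := (hcomm Q fun s => hQ.commute (hreal s)).smul_right (2 * Real.pi * I : ℂ)⁻¹
    exact ⟨h, ((hQ.commute hRa).pow_right _).sub_right h⟩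
  have hcommS : ∀ {Q : E →L[ℂ] E}, (∀ z P, ResolventAt A z P → Commute P Q) →
      Commute Q T ∧ Commute Q (W - T) := fun {Q} hQ => by
    have h := (hcomm Q fun s => (hQ _ _ (hreal s)).symm).smul_right (2 * Real.pi * I : ℂ)⁻¹
    exact ⟨h, ((hQ _ _ hRa).symm.pow_right _).sub_right h⟩
  have hWT : W * T = T * W := ((hcommT hRa).1.pow_left _).eq
  have hT1 : ∀ x, T x ∈ (W - T).ker := fun x => by
    change W (T x) - T (T x) = 0
    rw [← mul_apply_eq_comp, ← mul_apply_eq_comp, hTT, sub_self]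
  have hT2 : ∀ x, (W - T) x ∈ T.ker := fun x => by
    change T (W x - T x) = 0
    rw [map_sub, ← mul_apply_eq_comp, ← mul_apply_eq_comp, hTT, hWT, sub_self]
  have hSm : ∀ t : ℝ, 0 ≤ t → ∀ x ∈ T.ker, Sp t x ∈ T.ker ∧ Sm t x ∈ T.ker := fun t ht x hx =>
    ⟨apply_mem_ker_of_commute (hcommS fun z P hP => (hgen.commute hM.le hP ht).1).1 hx,
      apply_mem_ker_of_commute (hcommS fun z P hP => (hgen.commute hM.le hP ht).2).1 hx⟩
  have hSp : ∀ t : ℝ, 0 ≤ t → ∀ x ∈ (W - T).ker, Sp t x ∈ (W - T).ker ∧ Sm t x ∈ (W - T).ker :=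
    fun t ht x hx =>
    ⟨apply_mem_ker_of_commute (hcommS fun z P hP => (hgen.commute hM.le hP ht).1).2 hx,
      apply_mem_ker_of_commute (hcommS fun z P hP => (hgen.commute hM.le hP ht).2).2 hx⟩
  have hRm : ∀ z Q, ResolventAt A z Q → ∀ x ∈ T.ker, Q x ∈ T.ker := fun z Q hQ x hx =>
    apply_mem_ker_of_commute (hcommT hQ).1 hx
  have hRp : ∀ z Q, ResolventAt A z Q → ∀ x ∈ (W - T).ker, Q x ∈ (W - T).ker := fun z Q hQ x hx =>
    apply_mem_ker_of_commute (hcommT hQ).2 hx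
  have hcm := T.isClosed_ker
  have hcp := (W - T).isClosed_ker
  have hσm : {z : ℂ | ∃ k : ℤ, 1 ≤ k ∧ z = Complex.I * (lam k : ℂ)} ⊆
      resolventSet (partOf A T.ker) := by
    rintro _ ⟨k, hk, rfl⟩
    refine mem_resolventSet_partOf_of_im_pos hAclosed hcm hreal hRre
      (fun z hz => hRm z _ (hRre z hz)) ha_im hi (fun x hx => ?_) ?_ ?_
    · rw [← hJ, hJT, smul_apply, show T x = 0 from hx, smul_zero]
    · simpa using hpos k hk
    · simp
  have hσp : {z : ℂ | ∃ k : ℤ, k ≤ -1 ∧ z = Complex.I * (lam k : ℂ)} ⊆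
      resolventSet (partOf A (W - T).ker) := by
    rintro _ ⟨k, hk, rfl⟩
    refine mem_resolventSet_partOf_of_im_neg hAclosed hcp hreal hRre
      (fun z hz => hRp z _ (hRre z hz)) ha_im hRa hi (fun x hx => ?_) ?_ ?_
    · rw [← hJ, hJT, smul_apply, ← hW, ← sub_eq_zero.1 (show W x - T x = 0 from hx)]
    · simpa using hneg k (by lia)
    · simp
  have hmem : ∀ z, z ∈ resolventSet (partOf A (W - T).ker) → z ∈ resolventSet (partOf A T.ker) →
      z ∈ resolventSet A := fun z hp hm =>
    mem_resolventSet_of_partOf hRa (add_sub_cancel T W) hT1 hT2 (hcommT hRa).1 (hcommT hRa).2 hp hm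
  obtain ⟨Am, Spm, Smm, hAm, hcoem, hgenm, rfl⟩ := hgen.exists_restriction hcm hRm hSm
  obtain ⟨Ap, Spp, Smp, hAp, hcoep, hgenp, rfl⟩ := hgen.exists_restriction hcp hRp hSp
  refine ⟨T.ker, (W - T).ker, hcm, hcp, ?_, fun x hx => ?_, fun t ht => ⟨hSm t ht, hSp t ht⟩, M, hM,
    ⟨_, Spm, Smm, hAm, hcoem, hgenm, spectrumSet_partOf_eq hσ hRm hσm hσp fun z hz =>
      hmem z hz.2 hz.1⟩,
    ⟨_, Spp, Smp, hAp, hcoep, hgenp, spectrumSet_partOf_eq (Set.union_comm _ _ ▸ hσ) hRp hσp hσm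
      fun z hz => hmem z hz.1 hz.2⟩⟩
  · refine (Submodule.eq_bot_iff _).2 fun x ⟨h1, h2⟩ => hRa.pow_injective (m + 1) ?_
    rw [map_zero, ← hW, sub_eq_zero.1 (show W x - T x = 0 from h2)]
    exact h1
  · obtain ⟨y, rfl⟩ := hRa.exists_pow_apply_eq hx
    exact ⟨_, hT2 y, _, hT1 y, (sub_add_cancel (W y) (T y)).symm⟩

end SpectralDecomp
end

section
/- Suppose A generates an n-times integrated group bounded by M(1+|t|^m) (integers m ≥ n ≥ 0), with σ(A) = {iλ_k : k ∈ ℤ, k ≠ 0} as in the spectral assumption, and let P_k be the associated Riesz projections. Then the closed linear span of the union ⋃_{k ∈ ℤ, k ≠ 0} P_k(E) is all of E. -/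
open MeasureTheory Complex Filter Topology Metric

namespace SpectralDecomp

variable {G : Type*} [NormedAddCommGroup G] [NormedSpace ℂ G]

namespace ResolventAt

variable {A : G →ₗ.[ℂ] G} {z w : ℂ} {R S : G →L[ℂ] G}

/-- The resolvent identity. -/
theorem sub_eq_s1 (hR : ResolventAt A z R) (hS : ResolventAt A w S) :
    R - S = (w - z) • (R * S) := by
  ext y
  have h := hR.leftInv ⟨S y, hS.mem y⟩
  have h2 := hS.solves y
  have h3 : z • S y - A ⟨S y, hS.mem y⟩ = y - (w - z) • S y := by
    rw [sub_smul, eq_sub_iff_add_eq, ← add_sub_right_comm, add_sub_cancel]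
    exact h2
  simp only at h
  rw [h3, map_sub, map_smul] at h
  simp only [sub_apply, smul_apply, mul_apply_eq_comp]
  nth_rewrite 1 [← h]
  abel

protected theorem unique_s1 (hR : ResolventAt A z R) (hS : ResolventAt A z S) : R = S := by
  simpa [sub_eq_zero] using hR.sub_eq_s1 hS

theorem range_eq (hR : ResolventAt A z R) : Set.range R = (A.domain : Set G) := by
  ext x
  exact ⟨fun ⟨y, hy⟩ => hy ▸ hR.mem y, fun hx => ⟨_, hR.leftInv ⟨x, hx⟩⟩⟩

theorem mul_inverse (hR : ResolventAt A z R) (hu : IsUnit (1 + (w - z) • R)) :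
    ResolventAt A w (R * Ring.inverse (1 + (w - z) • R)) := by
  set V := Ring.inverse (1 + (w - z) • R)
  have hUV : ∀ y, V y + (w - z) • R (V y) = y := fun y => by
    simpa using congrArg (· y) (Ring.mul_inverse_cancel _ hu)
  have hVU : ∀ y, V (y + (w - z) • R y) = y := fun y => by
    simpa using congrArg (· y) (Ring.inverse_mul_cancel _ hu)
  refine ⟨fun y => hR.mem _, fun y => ?_, fun x => ?_⟩
  · calc w • R (V y) - A ⟨R (V y), hR.mem _⟩
        = (z • R (V y) - A ⟨R (V y), hR.mem _⟩) + (w - z) • R (V y) := by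
          rw [sub_smul]
          abel
      _ = y := by rw [hR.solves, hUV]
  · have h := hR.leftInv x
    have h2 : w • (x : G) - A x
        = (z • (x : G) - A x) + (w - z) • R (z • (x : G) - A x) := by
      rw [h, sub_smul]
      abel
    rw [mul_apply_eq_comp, h2, hVU, h]

end ResolventAt

section Resolvent

variable [CompleteSpace G] {A : G →ₗ.[ℂ] G} {Rres : ℂ → G →L[ℂ] G}

theorem eventually_isUnit_one_add_smul (R : G →L[ℂ] G) (z : ℂ) :
    ∀ᶠ w in 𝓝 z, IsUnit (1 + (w - z) • R) := by
  have hc : ContinuousAt (fun w : ℂ => 1 + (w - z) • R) z := by fun_prop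
  exact hc.eventually (Units.isOpen.mem_nhds (by simp))

theorem isOpen_resolventSet (A : G →ₗ.[ℂ] G) : IsOpen (resolventSet A) := by
  rw [isOpen_iff_mem_nhds]
  rintro z ⟨R, hR⟩
  filter_upwards [eventually_isUnit_one_add_smul R z] with w hw
  exact ⟨_, hR.mul_inverse hw⟩

theorem differentiableAt_resolvent (hres : ∀ z ∈ resolventSet A, ResolventAt A z (Rres z))
    {z : ℂ} (hz : z ∈ resolventSet A) : DifferentiableAt ℂ Rres z := by
  have heq : Rres =ᶠ[𝓝 z] fun w => Rres z * Ring.inverse (1 + (w - z) • Rres z) := by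
    filter_upwards [eventually_isUnit_one_add_smul (Rres z) z] with w hw
    have h := (hres z hz).mul_inverse hw
    exact (hres w ⟨_, h⟩).unique_s1 h
  refine DifferentiableAt.congr_of_eventuallyEq ?_ heq
  have hu : IsUnit (1 + (z - z) • Rres z) := by simp
  have h1 : DifferentiableAt ℂ (fun w : ℂ => 1 + (w - z) • Rres z) z := by fun_prop
  exact ((differentiableAt_inverse (𝕜 := ℂ) hu).comp z h1).const_mul (Rres z)

/-- If a functional annihilates the range of the Riesz projection on an isolating circle,
then `φ (R(·) x)` extends analytically to the disc. -/
theorem exists_analyticAt_of_rieszProj (hres : ∀ z ∈ resolventSet A, ResolventAt A z (Rres z))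
    {c : ℂ} {ρ : ℝ} (hρ : 0 < ρ)
    (hsep : ∀ z ∈ closedBall c ρ, z ≠ c → z ∈ resolventSet A)
    (φ : G →L[ℂ] ℂ) (hφ : ∀ x, φ (rieszProj Rres c ρ x) = 0) (x : G) :
    ∃ h : ℂ → ℂ, AnalyticAt ℂ h c ∧ (fun z => φ (Rres z x)) =ᶠ[𝓝[≠] c] h := by
  have hsphere : ∀ z ∈ sphere c ρ, z ∈ resolventSet A := fun z hz =>
    hsep z (sphere_subset_closedBall hz) (ne_of_mem_sphere hz hρ.ne')
  have hcont : ContinuousOn Rres (sphere c ρ) := fun z hz =>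
    (differentiableAt_resolvent hres (hsphere z hz)).continuousAt.continuousWithinAt
  have hzero : ∀ y, (∮ z in C(c, ρ), φ (Rres z y)) = 0 := fun y => by
    have h1 := hφ y
    let L : (G →L[ℂ] G) →L[ℂ] ℂ := φ.comp (ContinuousLinearMap.apply ℂ G y)
    have h2 : (∮ z in C(c, ρ), φ (Rres z y)) = L (∮ z in C(c, ρ), Rres z) := by
      have hi := (hcont.circleIntegrable hρ.le).out
      simp only [circleIntegral]
      rw [← L.intervalIntegral_comp_comm hi]
      simp [L]
    rw [h2]
    simpa [rieszProj, L, Real.pi_ne_zero] using h1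
  have hgc : ∀ y, ContinuousOn (fun z => φ (Rres z y)) (sphere c ρ) := fun y => by fun_prop
  lift ρ to NNReal using hρ.le
  have hps := hasFPowerSeriesOn_cauchy_integral ((hgc x).circleIntegrable hρ.le)
    (by exact_mod_cast hρ)
  refine ⟨_, hps.analyticAt, ?_⟩
  filter_upwards [self_mem_nhdsWithin, mem_nhdsWithin_of_mem_nhds (ball_mem_nhds c hρ)]
    with w hwc hw
  have hwr := hsep w (ball_subset_closedBall hw) hwc
  have hne : ∀ z ∈ sphere c (ρ : ℝ), z - w ≠ 0 := fun z hz h => by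
    rw [sub_eq_zero] at h
    subst h
    exact (mem_ball.1 hw).ne (mem_sphere.1 hz)
  have hEq : Set.EqOn (fun z => (z - w)⁻¹ • φ (Rres z x))
      (fun z => (φ (Rres w x)) * (z - w)⁻¹ - φ (Rres z (Rres w x))) (sphere c (ρ : ℝ)) := by
    intro z hz
    have h := congrArg (fun T : G →L[ℂ] G => φ (T x))
      ((hres z (hsphere z hz)).sub_eq_s1 (hres w hwr))
    simp only [sub_apply, smul_apply, mul_apply_eq_comp, map_sub, map_smul,
      smul_eq_mul] at h ⊢
    have := hne z hz
    field_simp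
    linear_combination h
  have hinv : ContinuousOn (fun z => φ (Rres w x) * (z - w)⁻¹) (sphere c (ρ : ℝ)) :=
    continuousOn_const.mul ((continuousOn_id.sub continuousOn_const).inv₀ hne)
  rw [circleIntegral.integral_congr hρ.le hEq, circleIntegral.integral_sub
    (hinv.circleIntegrable hρ.le) ((hgc _).circleIntegrable hρ.le), hzero,
    circleIntegral.integral_const_mul, circleIntegral.integral_sub_inv_of_mem_ball hw]
  have := Complex.two_pi_I_ne_zero
  simp only [smul_eq_mul]
  field_simp
  simp

end Resolvent

/-- A function which locally has removable singularities extends to an entire function. -/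
theorem exists_entire_extension {g : ℂ → ℂ}
    (hg : ∀ z, ∃ h : ℂ → ℂ, AnalyticAt ℂ h z ∧ g =ᶠ[𝓝[≠] z] h) :
    ∃ F : ℂ → ℂ, Differentiable ℂ F ∧ ∀ z, ContinuousAt g z → F z = g z := by
  have hlim : ∀ {z : ℂ} {h : ℂ → ℂ}, ContinuousAt h z → g =ᶠ[𝓝[≠] z] h →
      limUnder (𝓝[≠] z) g = h z := fun {z h} hc he =>
    ((hc.tendsto.mono_left nhdsWithin_le_nhds).congr' he.symm).limUnder_eq
  refine ⟨fun z => limUnder (𝓝[≠] z) g, fun z => ?_, fun z hz => hlim hz EventuallyEq.rfl⟩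
  obtain ⟨h, hh, he⟩ := hg z
  refine hh.differentiableAt.congr_of_eventuallyEq ?_
  have he' : ∀ᶠ w in 𝓝 z, w ≠ z → g w = h w := eventually_nhdsWithin_iff.1 he
  filter_upwards [he'.eventually_nhds, hh.eventually_analyticAt] with w hw hha
  refine hlim hha.continuousAt ?_
  by_cases hwz : w = z
  · rwa [hwz]
  · filter_upwards [mem_nhdsWithin_of_mem_nhds hw,
      mem_nhdsWithin_of_mem_nhds (isOpen_ne.mem_nhds hwz)] with v hv hvz using hv hvz

/-- A Liouville theorem for entire functions controlled off the imaginary axis. -/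
theorem entire_eq_zero_of_growth {F : ℂ → ℂ} (hF : Differentiable ℂ F) {C : ℝ} {m : ℕ}
    (hC : ∀ z : ℂ, 2 ≤ ‖z‖ → z.re ≠ 0 → ‖F z‖ * |z.re| ^ (m + 1) ≤ C * ‖z‖ ^ m) :
    ∀ z, F z = 0 := by
  intro w
  have key : ∀ R : ℝ, 2 ≤ R → ‖w‖ < R →
      ‖F w‖ * ‖w ^ 2 + (R : ℂ) ^ 2‖ ^ (m + 1) ≤ 2 ^ (m + 1) * |C| * R ^ (2 * m + 1) := by
    intro R hR hw
    have hR0 : 0 < R := by linarith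
    have hd : Differentiable ℂ fun z : ℂ => F z * (z ^ 2 + (R : ℂ) ^ 2) ^ (m + 1) := by fun_prop
    have := norm_le_of_forall_mem_frontier_norm_le (U := ball (0 : ℂ) R)
      (C := 2 ^ (m + 1) * |C| * R ^ (2 * m + 1)) isBounded_ball hd.diffContOnCl ?_
      (subset_closure (by simpa using hw))
    · simpa using this
    intro z hz
    rw [frontier_ball _ hR0.ne', mem_sphere_zero_iff_norm] at hz
    have hsq : z ^ 2 + (R : ℂ) ^ 2 = z * (2 * z.re : ℝ) := by
      have h1 : (R : ℂ) ^ 2 = z * (starRingEnd ℂ) z := by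
        rw [Complex.mul_conj, Complex.normSq_eq_norm_sq, hz]
        push_cast
        rfl
      rw [h1, Complex.ofReal_mul, ← Complex.ofReal_mul, ← Complex.add_conj]
      ring
    rw [hsq, norm_mul, norm_pow, norm_mul, hz, Complex.norm_real, Real.norm_eq_abs, abs_mul,
      abs_two]
    by_cases hre : z.re = 0
    · rw [hre]
      simp
      positivity
    · have h := hC z (by rw [hz]; exact hR) hre
      rw [hz] at h
      calc ‖F z‖ * (R * (2 * |z.re|)) ^ (m + 1)
          = (2 ^ (m + 1) * R ^ (m + 1)) * (‖F z‖ * |z.re| ^ (m + 1)) := by ring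
        _ ≤ (2 ^ (m + 1) * R ^ (m + 1)) * (C * R ^ m) := by gcongr
        _ ≤ (2 ^ (m + 1) * R ^ (m + 1)) * (|C| * R ^ m) := by gcongr; exact le_abs_self C
        _ = 2 ^ (m + 1) * |C| * R ^ (2 * m + 1) := by ring
  have key2 : ∀ᶠ R : ℝ in atTop, ‖F w‖ ≤ 4 ^ (m + 1) * |C| / R := by
    filter_upwards [eventually_ge_atTop (2 * (‖w‖ + 1))] with R hR
    have hw0 := norm_nonneg w
    have hR0 : 0 < R := by linarith
    have h1 := key R (by linarith) (by linarith)
    have h2 : R ^ 2 / 2 ≤ ‖w ^ 2 + (R : ℂ) ^ 2‖ := by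
      have h3 := norm_sub_norm_le ((R : ℂ) ^ 2) (-w ^ 2)
      rw [norm_neg, norm_pow, norm_pow, Complex.norm_real, Real.norm_eq_abs, sq_abs,
        sub_neg_eq_add, add_comm] at h3
      nlinarith
    have h4 : ‖F w‖ * (R ^ 2 / 2) ^ (m + 1) ≤ 2 ^ (m + 1) * |C| * R ^ (2 * m + 1) :=
      le_trans (by gcongr) h1
    rw [le_div_iff₀ hR0]
    have h5 : 0 < R ^ (2 * m + 1) / 2 ^ (m + 1) := by positivity
    refine le_of_mul_le_mul_right ?_ h5
    calc ‖F w‖ * R * (R ^ (2 * m + 1) / 2 ^ (m + 1))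
        = ‖F w‖ * (R ^ 2 / 2) ^ (m + 1) := by rw [div_pow]; ring
      _ ≤ _ := h4
      _ = 4 ^ (m + 1) * |C| * (R ^ (2 * m + 1) / 2 ^ (m + 1)) := by
        rw [show (4 : ℝ) = 2 * 2 by norm_num, mul_pow]
        field_simp
  exact norm_le_zero_iff.1 (ge_of_tendsto (tendsto_const_nhds.div_atTop tendsto_id) key2)

theorem norm_laplace_le {S : ℝ → G →L[ℂ] G} {m : ℕ} {M : ℝ} (hM : 0 ≤ M)
    (hS : ∀ t : ℝ, 0 ≤ t → ‖S t‖ ≤ M * (1 + t ^ m)) {z : ℂ} (hz : 0 < z.re) (x : G) :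
    ‖∫ t in Set.Ioi (0 : ℝ), Complex.exp (-z * t) • S t x‖ ≤
      (2 * M * (1 + m.factorial * 2 ^ m)) * ‖x‖ * (1 / z.re + 1 / z.re ^ (m + 1)) := by
  set a := z.re with ha
  have hneg : -(a / 2) < 0 := by linarith
  have hint := (integrableOn_exp_mul_Ioi hneg 0).const_mul
    (M * (1 + m.factorial * (2 / a) ^ m) * ‖x‖)
  have hval := integral_exp_mul_Ioi hneg 0
  refine (norm_integral_le_of_norm_le hint ?_).trans ?_
  · refine (ae_restrict_iff' measurableSet_Ioi).2 (ae_of_all _ fun t (ht : 0 < t) => ?_)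
    have h1 : t ^ m ≤ m.factorial * (2 / a) ^ m * Real.exp (a / 2 * t) := by
      have := Real.pow_div_factorial_le_exp (a / 2 * t) (by positivity) m
      rw [div_le_iff₀ (by positivity), mul_pow] at this
      calc t ^ m = (2 / a) ^ m * ((a / 2) ^ m * t ^ m) := by
            rw [← mul_assoc, ← mul_pow]
            field_simp
            simp
        _ ≤ (2 / a) ^ m * (Real.exp (a / 2 * t) * m.factorial) := by gcongr
        _ = _ := by ring
    have h2 : 1 ≤ Real.exp (a / 2 * t) := Real.one_le_exp (by positivity)
    have h3 : ‖Complex.exp (-z * t)‖ = Real.exp (-(a / 2) * t) * Real.exp (-(a / 2) * t) := by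
      rw [Complex.norm_exp, ← Real.exp_add]
      congr 1
      simp
      ring
    have h4 : Real.exp (-(a / 2) * t) * Real.exp (a / 2 * t) = 1 := by
      rw [← Real.exp_add]
      simp
    rw [norm_smul, h3]
    have h5 : ‖S t x‖ ≤ M * ((1 + m.factorial * (2 / a) ^ m) * Real.exp (a / 2 * t)) * ‖x‖ := by
      refine ((S t).le_opNorm x).trans ?_
      gcongr
      refine (hS t ht.le).trans ?_
      gcongr
      linarith
    calc _ ≤ Real.exp (-(a / 2) * t) * Real.exp (-(a / 2) * t) *
          (M * ((1 + m.factorial * (2 / a) ^ m) * Real.exp (a / 2 * t)) * ‖x‖) := by gcongr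
      _ = (Real.exp (-(a / 2) * t) * Real.exp (a / 2 * t)) *
          (M * (1 + m.factorial * (2 / a) ^ m) * ‖x‖ * Real.exp (-(a / 2) * t)) := by ring
      _ = _ := by rw [h4, one_mul]
  · rw [integral_const_mul, hval]
    have h1 : (1 + m.factorial * (2 / a) ^ m) * (1 / a) ≤
        (1 + m.factorial * 2 ^ m) * (1 / a + 1 / a ^ (m + 1)) := by
      have : 0 ≤ 1 / a ^ (m + 1) + m.factorial * 2 ^ m * (1 / a) := by positivity
      calc _ = 1 / a + m.factorial * 2 ^ m * (1 / a ^ (m + 1)) := by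
            rw [div_pow]
            field_simp
            ring
        _ ≤ _ := by linarith
    have h2 : -Real.exp (-(a / 2) * 0) / -(a / 2) = 2 * (1 / a) := by
      simp
      field_simp
    rw [h2]
    have h3 : 0 ≤ 2 * M * ‖x‖ := by positivity
    have := mul_le_mul_of_nonneg_left h1 h3
    linarith

/-- The resolvent of the generator grows polynomially off the imaginary axis. -/
theorem Generates.norm_resolvent_le {A : G →ₗ.[ℂ] G} {n m : ℕ} {M : ℝ}
    {Sp Sm : ℝ → G →L[ℂ] G} (hgen : Generates A n m M Sp Sm) (hM : 0 ≤ M) {z : ℂ}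
    (hz : z.re ≠ 0) {R : G →L[ℂ] G} (hR : ResolventAt A z R) (x : G) :
    ‖R x‖ ≤ (2 * M * (1 + m.factorial * 2 ^ m)) * ‖x‖ * ‖z‖ ^ n *
      (1 / |z.re| + 1 / |z.re| ^ (m + 1)) := by
  obtain ⟨-, -, hSp, hSm, hL⟩ := hgen
  rcases hz.lt_or_gt with h | h
  · have h' : 0 < (-z).re := by simpa using h
    obtain ⟨-, T, hT, hTx⟩ := hL (-z) h'
    rw [neg_neg] at hT
    rw [hR.unique_s1 hT, ← norm_neg, hTx x, norm_smul, norm_pow, norm_neg]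
    have := norm_laplace_le hM hSm h' x
    rw [abs_of_neg h, ← Complex.neg_re]
    refine (mul_le_mul_of_nonneg_left this (by positivity)).trans_eq (by ring)
  · obtain ⟨⟨T, hT, hTx⟩, -⟩ := hL z h
    rw [hR.unique_s1 hT, hTx x, norm_smul, norm_pow]
    have := norm_laplace_le hM hSp h x
    rw [abs_of_pos h]
    refine (mul_le_mul_of_nonneg_left this (by positivity)).trans_eq (by ring)

/-- Powers of a fixed resolvent improve the decay of the resolvent at infinity. -/
theorem exists_norm_resolvent_pow_le (A : G →ₗ.[ℂ] G) {T : G →L[ℂ] G}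
    (hT : ResolventAt A 1 T) (y : G) (N : ℕ) :
    ∃ C : ℝ, 0 ≤ C ∧ ∀ z R, ResolventAt A z R → 2 ≤ ‖z‖ →
      ‖R ((T ^ N) y)‖ ≤ C * (‖R y‖ / ‖z‖ ^ N + 1 / ‖z‖) := by
  induction N with
  | zero => exact ⟨1, zero_le_one, fun z R _ _ => by simp⟩
  | succ N ih =>
    obtain ⟨C, hC0, hC⟩ := ih
    refine ⟨2 * (C + ‖T ((T ^ N) y)‖), by positivity, fun z R hR hz => ?_⟩
    have hz0 : 0 < ‖z‖ := by linarith
    have h1 : ‖R ((T ^ N) y) - T ((T ^ N) y)‖ = ‖1 - z‖ * ‖R ((T ^ (N + 1)) y)‖ := by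
      have := congrArg (fun U : G →L[ℂ] G => U ((T ^ N) y)) (hR.sub_eq_s1 hT)
      simp only [sub_apply, smul_apply, mul_apply_eq_comp] at this
      rw [this, norm_smul, pow_succ', mul_apply_eq_comp]
    have h2 : ‖z‖ / 2 ≤ ‖1 - z‖ := by
      have := norm_sub_norm_le z 1
      rw [norm_one, norm_sub_rev] at this
      linarith
    have h3 := hC z R hR hz
    set K := ‖T ((T ^ N) y)‖
    set r := ‖R y‖
    have hr : 0 ≤ r := norm_nonneg _
    have hK : 0 ≤ K := norm_nonneg _
    have h4 : ‖z‖ / 2 * ‖R ((T ^ (N + 1)) y)‖ ≤ C * (r / ‖z‖ ^ N + 1 / ‖z‖) + K := by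
      calc _ ≤ ‖1 - z‖ * ‖R ((T ^ (N + 1)) y)‖ := by gcongr
        _ ≤ ‖R ((T ^ N) y)‖ + K := h1 ▸ norm_sub_le _ _
        _ ≤ _ := by gcongr
    have h5 : 1 / ‖z‖ ≤ 1 := by
      rw [div_le_one hz0]; linarith
    have h6 : C * (r / ‖z‖ ^ N + 1 / ‖z‖) + K ≤ (C + K) * (r / ‖z‖ ^ N + 1) := by
      have : 0 ≤ K * (r / ‖z‖ ^ N) := by positivity
      nlinarith
    have h7 : 2 * (C + K) * (r / ‖z‖ ^ (N + 1) + 1 / ‖z‖) =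
        2 / ‖z‖ * ((C + K) * (r / ‖z‖ ^ N + 1)) := by
      rw [pow_succ]
      field_simp
    rw [h7]
    calc ‖R ((T ^ (N + 1)) y)‖ = 2 / ‖z‖ * (‖z‖ / 2 * ‖R ((T ^ (N + 1)) y)‖) := by field_simp
      _ ≤ _ := mul_le_mul_of_nonneg_left (h4.trans h6) (by positivity)

theorem denseRange_pow {T : G →L[ℂ] G} (hT : DenseRange T) (N : ℕ) : DenseRange ⇑(T ^ N) := by
  induction N with
  | zero => exact Function.surjective_id.denseRange
  | succ N ih =>
    rw [pow_succ']
    exact hT.comp ih T.continuous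

theorem dense_of_forall_dual_eq_zero (p : Submodule ℂ G)
    (h : ∀ φ : G →L[ℂ] ℂ, (∀ x ∈ p, φ x = 0) → φ = 0) : Dense (p : Set G) := by
  rw [Submodule.dense_iff_topologicalClosure_eq_top, Submodule.eq_top_iff']
  intro x
  by_contra hx
  have hcl : IsClosed (p.topologicalClosure : Set G) := p.isClosed_topologicalClosure
  have hx' : p.topologicalClosure.mkQ x ≠ 0 := by simpa using hx
  obtain ⟨ψ, hψ⟩ := SeparatingDual.exists_eq_one (R := ℂ) hx'
  have := h (ψ.comp p.topologicalClosure.mkQL) fun y hy => by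
    have : p.topologicalClosure.mkQ y = 0 := by
      simpa using p.le_topologicalClosure hy
    change ψ (p.topologicalClosure.mkQ y) = 0
    rw [this, map_zero]
  have h0 := congrArg (· x) this
  change ψ (p.topologicalClosure.mkQ x) = 0 at h0
  rw [hψ] at h0
  exact one_ne_zero h0

/-- If `A` generates an `n`-times integrated group bounded by `M (1 + |t| ^ m)`
(`m ≥ n`) and has discrete spectrum `σ(A) = {iλ_k : k ∈ ℤ, k ≠ 0}` as in the
spectral assumption, then the closed linear span of the union of the ranges of
the Riesz projections `P_k` is all of `E`. -/
theorem dense_span_rieszProj_ranges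
    {E : Type*} [NormedAddCommGroup E] [NormedSpace ℂ E] [CompleteSpace E]
    (A : E →ₗ.[ℂ] E)
    (hAclosed : IsClosed (A.graph : Set (E × E)))
    (hAdense : Dense (A.domain : Set E))
    (n m : ℕ) (hnm : n ≤ m) (M : ℝ) (hM : 0 < M)
    (Sp Sm : ℝ → E →L[ℂ] E) (hgen : Generates A n m M Sp Sm)
    (Rres : ℂ → E →L[ℂ] E)
    (hres : ∀ z ∈ resolventSet A, ResolventAt A z (Rres z))
    (lam : ℤ → ℝ)
    (hmono : ∀ j k : ℤ, j ≠ 0 → k ≠ 0 → j < k → lam j < lam k)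
    (hpos : ∀ k : ℤ, 0 < k → 0 < lam k)
    (hneg : ∀ k : ℤ, k < 0 → lam k < 0)
    (hspec : spectrumSet A = {z : ℂ | ∃ k : ℤ, k ≠ 0 ∧ z = Complex.I * (lam k : ℂ)})
    (r : ℤ → ℝ) (hrpos : ∀ k : ℤ, k ≠ 0 → 0 < r k)
    (hrsep : ∀ k : ℤ, k ≠ 0 → ∀ z ∈ spectrumSet A,
      z ∈ Metric.closedBall (Complex.I * (lam k : ℂ)) (r k) → z = Complex.I * (lam k : ℂ)) :
    Dense (↑(Submodule.span ℂ
      (⋃ k ∈ {k : ℤ | k ≠ 0},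
        Set.range ⇑(rieszProj Rres (Complex.I * (lam k : ℂ)) (r k)))) : Set E) := by
  have hgood : ∀ z : ℂ, z.re ≠ 0 → z ∈ resolventSet A := fun z hz => by
    by_contra h
    have : z ∈ spectrumSet A := h
    rw [hspec] at this
    obtain ⟨k, -, rfl⟩ := this
    simp at hz
  have hT : ResolventAt A 1 (Rres 1) := hres 1 (hgood 1 (by simp))
  have hTdense : DenseRange ⇑(Rres 1) := by
    rw [DenseRange, hT.range_eq]
    exact hAdense
  refine dense_of_forall_dual_eq_zero _ fun φ hφ => ?_
  have hP : ∀ k : ℤ, k ≠ 0 → ∀ x, φ (rieszProj Rres (Complex.I * (lam k : ℂ)) (r k) x) = 0 :=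
    fun k hk x => hφ _ (Submodule.subset_span (Set.mem_biUnion hk ⟨x, rfl⟩))
  have han : ∀ x z, z ∈ resolventSet A → AnalyticAt ℂ (fun z => φ (Rres z x)) z :=
    fun x z hz => by
      refine DifferentiableOn.analyticAt (s := resolventSet A) (fun w hw => ?_)
        ((isOpen_resolventSet A).mem_nhds hz)
      have := differentiableAt_resolvent hres hw
      exact DifferentiableAt.differentiableWithinAt (by fun_prop)
  have hvanish : ∀ y, φ (Rres 1 ((Rres 1 ^ n) y)) = 0 := fun y => by
    set x := (Rres 1 ^ n) y with hx
    have hloc : ∀ z, ∃ h : ℂ → ℂ, AnalyticAt ℂ h z ∧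
        (fun z => φ (Rres z x)) =ᶠ[𝓝[≠] z] h := fun z => by
      by_cases hz : z ∈ resolventSet A
      · exact ⟨_, han x z hz, EventuallyEq.rfl⟩
      · have hz' : z ∈ spectrumSet A := hz
        rw [hspec] at hz'
        obtain ⟨k, hk, rfl⟩ := hz'
        refine exists_analyticAt_of_rieszProj hres (hrpos k hk) (fun w hw hne => ?_) φ
          (hP k hk) x
        by_contra hw'
        exact hne (hrsep k hk w hw' hw)
    obtain ⟨F, hF, hFg⟩ := exists_entire_extension hloc
    obtain ⟨C, hC0, hC⟩ := exists_norm_resolvent_pow_le A hT y n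
    set B := 2 * M * (1 + m.factorial * 2 ^ m) * ‖y‖ with hB
    have hB0 : 0 ≤ B := by positivity
    have hF0 := entire_eq_zero_of_growth (m := m) (C := ‖φ‖ * (C * (2 * B + 1))) hF
      fun z hz hre => ?_
    · rw [← hF0 1, hFg 1 (han x 1 (hgood 1 (by simp))).continuousAt]
    have hzr := hres z (hgood z hre)
    rw [hFg z (han x z (hgood z hre)).continuousAt]
    have h1 := hC z _ hzr hz
    have h2 := hgen.norm_resolvent_le hM.le hre hzr y
    rw [← hx] at h1
    have hz0 : 0 < ‖z‖ := by linarith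
    have ha0 : 0 < |z.re| := abs_pos.2 hre
    have haz : |z.re| ≤ ‖z‖ := Complex.abs_re_le_norm z
    have h3 : ‖Rres z y‖ / ‖z‖ ^ n ≤ B * (1 / |z.re| + 1 / |z.re| ^ (m + 1)) := by
      rw [div_le_iff₀ (by positivity)]
      exact h2.trans_eq (by rw [hB]; ring)
    have h4 : (B * (1 / |z.re| + 1 / |z.re| ^ (m + 1)) + 1 / ‖z‖) * |z.re| ^ (m + 1) ≤
        (2 * B + 1) * ‖z‖ ^ m := by
      have e1 : (B * (1 / |z.re| + 1 / |z.re| ^ (m + 1)) + 1 / ‖z‖) * |z.re| ^ (m + 1) =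
          B * (|z.re| ^ m + 1) + |z.re| ^ m * (|z.re| / ‖z‖) := by
        rw [pow_succ]
        field_simp
      have e2 : |z.re| ^ m ≤ ‖z‖ ^ m := by gcongr
      have e3 : 1 ≤ ‖z‖ ^ m := one_le_pow₀ (by linarith)
      have e4 : |z.re| / ‖z‖ ≤ 1 := (div_le_one hz0).2 haz
      rw [e1]
      calc _ ≤ B * (‖z‖ ^ m + ‖z‖ ^ m) + ‖z‖ ^ m * 1 := by gcongr
        _ = _ := by ring
    calc ‖φ (Rres z x)‖ * |z.re| ^ (m + 1)
        ≤ ‖φ‖ * (C * (B * (1 / |z.re| + 1 / |z.re| ^ (m + 1)) + 1 / ‖z‖)) *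
          |z.re| ^ (m + 1) := by
          gcongr
          refine (φ.le_opNorm _).trans ?_
          gcongr
          exact h1.trans (by gcongr)
      _ = ‖φ‖ * (C * ((B * (1 / |z.re| + 1 / |z.re| ^ (m + 1)) + 1 / ‖z‖) *
          |z.re| ^ (m + 1))) := by ring
      _ ≤ ‖φ‖ * (C * ((2 * B + 1) * ‖z‖ ^ m)) := by gcongr
      _ = _ := by ring
  have hdense := denseRange_pow hTdense (n + 1)
  have hfun : ⇑φ = ⇑(0 : E →L[ℂ] ℂ) := by
    refine hdense.equalizer φ.continuous continuous_const (funext fun y => ?_)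
    simpa [pow_succ'] using hvanish y
  exact DFunLike.coe_injective hfun

end SpectralDecomp
end
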